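/- arXiv:1210.2389 — 4 statements merged into one kernel-verified Lean document; each statement's English description precedes it below -/
import Mathlib

section
/- Let m ≥ 1 be an integer and let α, β ∈ ℂ satisfy Re α > -m, Re β > -m and Re(α+β) < -m. Then for every x ∈ ℝ^m with x ≠ 0, the function y ↦ |x-y|^α |y|^β is integrable on ℝ^m and ∫_{ℝ^m} |x-y|^α |y|^β dy = π^{m/2} · [Γ((α+m)/2) Γ((β+m)/2) Γ(-(α+β+m)/2)] / [Γ(-α/2) Γ(-β/2) Γ((α+β+2m)/2)] · |x|^{α+β+m}. (This is the convolution formula T*_α ∗ T*_β = π^{m/2} Γ(-(α+β+m)/2)/(Γ(-α/2)Γ(-β/2)) · T*_{α+β+m} of Proposition 2.1(i), written for the underlying locally integrable functions in the parameter region where the convolution integral converges absolutely.) -/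
open MeasureTheory Set

lemma Complex.ofReal_cpow_eq_exp_log_mul {r : ℝ} (hr : 0 < r) (a : ℂ) :
    (r : ℂ) ^ a = Complex.exp (Real.log r * a) := by
  rw [Complex.cpow_def_of_ne_zero (Complex.ofReal_ne_zero.2 hr.ne'), Complex.ofReal_log hr.le]

/-- The integrand of the scaled Gamma integral. -/
noncomputable def gammaKernel (a : ℂ) (r t : ℝ) : ℂ :=
  (t : ℂ) ^ (a - 1) * Complex.exp (-(r * t))

lemma integral_gammaKernel {a : ℂ} (ha : 0 < a.re) {r : ℝ} (hr : 0 < r) :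
    ∫ t in Ioi 0, gammaKernel a r t = ((1 / r : ℝ) : ℂ) ^ a * Complex.Gamma a := by
  simpa [gammaKernel] using Complex.integral_cpow_mul_exp_neg_mul_Ioi ha hr

lemma norm_gammaKernel (a : ℂ) (r : ℝ) {t : ℝ} (ht : 0 < t) :
    ‖gammaKernel a r t‖ = t ^ (a.re - 1) * Real.exp (-(r * t)) := by
  rw [gammaKernel, norm_mul, Complex.norm_cpow_eq_rpow_re_of_pos ht, Complex.norm_exp]
  simp

lemma integral_norm_gammaKernel {a : ℂ} (ha : 0 < a.re) {r : ℝ} (hr : 0 < r) :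
    ∫ t in Ioi 0, ‖gammaKernel a r t‖ = ‖((1 / r : ℝ) : ℂ) ^ a‖ * Real.Gamma a.re := by
  rw [setIntegral_congr_fun measurableSet_Ioi fun t ht => norm_gammaKernel a r ht,
    Real.integral_rpow_mul_exp_neg_mul_Ioi ha hr,
    Complex.norm_cpow_eq_rpow_re_of_pos (one_div_pos.2 hr)]

lemma measurable_gammaKernel (a : ℂ) :
    Measurable fun p : ℝ × ℝ => gammaKernel a p.1 p.2 := by
  unfold gammaKernel
  fun_prop

lemma integrableOn_gammaKernel {a : ℂ} (ha : 0 < a.re) {r : ℝ} (hr : 0 < r) :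
    IntegrableOn (gammaKernel a r) (Ioi 0) := by
  have hm : Measurable (gammaKernel a r) :=
    (measurable_gammaKernel a).comp (measurable_const.prodMk measurable_id)
  rw [IntegrableOn, ← integrable_norm_iff hm.aestronglyMeasurable]
  refine .of_integral_ne_zero ?_
  rw [integral_norm_gammaKernel ha hr, Complex.norm_cpow_eq_rpow_re_of_pos (one_div_pos.2 hr)]
  exact (mul_pos (Real.rpow_pos_of_pos (one_div_pos.2 hr) _) (Real.Gamma_pos_of_pos ha)).ne'

/-- Integrability of the integrand in Euler's Beta integral on the half-line, and its value. -/
lemma integrableOn_and_integral_beta_Ioi {u v : ℂ} (hu : 0 < u.re) (hv : 0 < v.re) :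
    IntegrableOn (fun r : ℝ => (r : ℂ) ^ (u - 1) * ((1 + r : ℝ) : ℂ) ^ (-(u + v))) (Ioi 0) ∧
    ∫ r in Ioi (0 : ℝ), (r : ℂ) ^ (u - 1) * ((1 + r : ℝ) : ℂ) ^ (-(u + v)) =
      Complex.Gamma u * Complex.Gamma v / Complex.Gamma (u + v) := by
  set μ : Measure ℝ := volume.restrict (Ioi 0) with hμ
  have huv : 0 < (u + v).re := by simpa using add_pos hu hv
  have hpos : ∀ᵐ t ∂μ, 0 < t := self_mem_ae_restrict measurableSet_Ioi
  let F : ℝ × ℝ → ℂ := fun p => gammaKernel (u + v) 1 p.1 * gammaKernel u p.1 p.2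
  have hFm : Measurable F :=
    ((measurable_gammaKernel (u + v)).comp (measurable_const.prodMk measurable_fst)).mul
      (measurable_gammaKernel u)
  have key : ∀ t : ℝ, 0 < t →
      gammaKernel (u + v) 1 t * ((1 / t : ℝ) : ℂ) ^ u = gammaKernel v 1 t := by
    intro t ht
    simp only [gammaKernel, Complex.ofReal_cpow_eq_exp_log_mul ht,
      Complex.ofReal_cpow_eq_exp_log_mul (one_div_pos.2 ht), ← Complex.exp_add]
    congr 1
    simp only [one_div, Real.log_inv, Complex.ofReal_neg]
    ring
  have hF : Integrable F (μ.prod μ) := by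
    rw [integrable_prod_iff hFm.aestronglyMeasurable]
    constructor
    · filter_upwards [hpos] with t ht
      exact (integrableOn_gammaKernel hu ht).const_mul (gammaKernel (u + v) 1 t)
    · refine ((integrableOn_gammaKernel hv one_pos).norm.mul_const (Real.Gamma u.re)).congr ?_
      filter_upwards [hpos] with t ht
      simp only [F, norm_mul]
      rw [integral_const_mul, integral_norm_gammaKernel hu ht, ← key t ht, norm_mul, mul_assoc]
  have h1 : ∫ z, F z ∂μ.prod μ = Complex.Gamma u * Complex.Gamma v := by
    rw [integral_prod _ hF]
    have : ∫ t, ∫ r, F (t, r) ∂μ ∂μ = ∫ t, gammaKernel v 1 t * Complex.Gamma u ∂μ := by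
      refine integral_congr_ae ?_
      filter_upwards [hpos] with t ht
      simp only [F]
      rw [integral_const_mul, integral_gammaKernel hu ht, ← key t ht, mul_assoc]
    rw [this, integral_mul_const, integral_gammaKernel hv one_pos]
    simp [mul_comm]
  have h2 : (fun r => ∫ t, F (t, r) ∂μ) =ᵐ[μ] fun r : ℝ =>
      Complex.Gamma (u + v) * ((r : ℂ) ^ (u - 1) * ((1 + r : ℝ) : ℂ) ^ (-(u + v))) := by
    filter_upwards [hpos] with r hr
    have hr1 : 0 < 1 + r := by positivity
    have : ∀ t, F (t, r) = (r : ℂ) ^ (u - 1) * gammaKernel (u + v) (1 + r) t := by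
      intro t
      simp only [F, gammaKernel]
      have : Complex.exp (-(((1 + r : ℝ) : ℂ) * t)) =
          Complex.exp (-(((1 : ℝ) : ℂ) * t)) * Complex.exp (-(t * r)) := by
        rw [← Complex.exp_add]; congr 1; push_cast; ring
      rw [this]; ring
    simp only [this]
    rw [integral_const_mul, integral_gammaKernel huv hr1,
      Complex.ofReal_cpow_eq_exp_log_mul (one_div_pos.2 hr1),
      Complex.ofReal_cpow_eq_exp_log_mul hr1, one_div, Real.log_inv]
    push_cast
    ring_nf
  have hΓ : Complex.Gamma (u + v) ≠ 0 := Complex.Gamma_ne_zero_of_re_pos huv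
  constructor
  · have := (hF.integral_prod_right.congr h2).const_mul (Complex.Gamma (u + v))⁻¹
    simpa [inv_mul_cancel_left₀ hΓ, IntegrableOn] using this
  · rw [eq_div_iff hΓ, ← h1, integral_prod_symm _ hF, integral_congr_ae h2, integral_const_mul,
      mul_comm]

/-- The kernel obtained from `rieszKernel` by integrating out `y`. -/
noncomputable def reducedKernel (a b d : ℂ) (X : ℝ) (p : ℝ × ℝ) : ℂ :=
  (p.1 : ℂ) ^ (a - 1) * ((1 + p.1 : ℝ) : ℂ) ^ (-d) *
    gammaKernel (a + b - d) (p.1 / (1 + p.1) * X) p.2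

lemma integrable_and_integral_reducedKernel {a b d : ℂ} (ha : a.re < d.re) (hb : b.re < d.re)
    (hab : d.re < a.re + b.re) {X : ℝ} (hX : 0 < X) :
    Integrable (reducedKernel a b d X)
      ((volume.restrict (Ioi 0)).prod (volume.restrict (Ioi 0))) ∧
    ∫ p, reducedKernel a b d X p ∂((volume.restrict (Ioi 0)).prod (volume.restrict (Ioi 0))) =
      (X : ℂ) ^ (d - a - b) * (Complex.Gamma (a + b - d) *
        (Complex.Gamma (d - b) * Complex.Gamma (d - a) / Complex.Gamma (2 * d - a - b))) := by
  set μ : Measure ℝ := volume.restrict (Ioi 0) with hμ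
  have hpos : ∀ᵐ t ∂μ, 0 < t := self_mem_ae_restrict measurableSet_Ioi
  have hc : 0 < (a + b - d).re := by simpa using hab
  have hu : 0 < (d - b).re := by simpa using hb
  have hv : 0 < (d - a).re := by simpa using ha
  obtain ⟨hi, hI⟩ := integrableOn_and_integral_beta_Ioi hu hv
  have hρ : ∀ r : ℝ, 0 < r → 0 < r / (1 + r) * X := fun r hr => by positivity
  have key : ∀ r : ℝ, 0 < r →
      (r : ℂ) ^ (a - 1) * ((1 + r : ℝ) : ℂ) ^ (-d) *
        ((1 / (r / (1 + r) * X) : ℝ) : ℂ) ^ (a + b - d) =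
      (X : ℂ) ^ (d - a - b) *
        ((r : ℂ) ^ (d - b - 1) * ((1 + r : ℝ) : ℂ) ^ (-(d - b + (d - a)))) := by
    intro r hr
    have hr1 : 0 < 1 + r := by positivity
    rw [Complex.ofReal_cpow_eq_exp_log_mul hr, Complex.ofReal_cpow_eq_exp_log_mul hr1,
      Complex.ofReal_cpow_eq_exp_log_mul hr, Complex.ofReal_cpow_eq_exp_log_mul hr1,
      Complex.ofReal_cpow_eq_exp_log_mul hX,
      Complex.ofReal_cpow_eq_exp_log_mul (one_div_pos.2 (hρ r hr)), one_div, Real.log_inv,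
      Real.log_mul (by positivity) hX.ne', Real.log_div hr.ne' hr1.ne']
    simp only [← Complex.exp_add]
    congr 1
    push_cast
    ring
  have hm : Measurable (reducedKernel a b d X) := by
    unfold reducedKernel gammaKernel
    fun_prop
  have hint : Integrable (reducedKernel a b d X) (μ.prod μ) := by
    rw [integrable_prod_iff hm.aestronglyMeasurable]
    constructor
    · filter_upwards [hpos] with r hr
      exact (integrableOn_gammaKernel hc (hρ r hr)).const_mul
        ((r : ℂ) ^ (a - 1) * ((1 + r : ℝ) : ℂ) ^ (-d))
    · refine ((hi.const_mul ((X : ℂ) ^ (d - a - b))).norm.mul_const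
        (Real.Gamma (a + b - d).re)).congr ?_
      filter_upwards [hpos] with r hr
      simp only [reducedKernel]
      simp only [norm_mul _ (gammaKernel _ _ _)]
      rw [integral_const_mul, integral_norm_gammaKernel hc (hρ r hr), ← key r hr, ← mul_assoc,
        ← norm_mul]
  refine ⟨hint, ?_⟩
  rw [integral_prod _ hint]
  have : ∫ r, ∫ t, reducedKernel a b d X (r, t) ∂μ ∂μ = ∫ r : ℝ, (X : ℂ) ^ (d - a - b) *
      ((r : ℂ) ^ (d - b - 1) * ((1 + r : ℝ) : ℂ) ^ (-(d - b + (d - a)))) *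
        Complex.Gamma (a + b - d) ∂μ := by
    refine integral_congr_ae ?_
    filter_upwards [hpos] with r hr
    simp only [reducedKernel]
    rw [integral_const_mul, integral_gammaKernel hc (hρ r hr), ← key r hr, ← mul_assoc]
  rw [this, integral_mul_const, integral_const_mul, hI,
    show d - b + (d - a) = 2 * d - a - b by ring]
  ring

section Riesz

variable {V : Type*} [NormedAddCommGroup V]

/-- The kernel whose integral in `p` is a multiple of `‖x - y‖ ^ (-2a) * ‖y‖ ^ (-2b)`. -/
noncomputable def rieszKernel (a b : ℂ) (x : V) (p : ℝ × ℝ) (y : V) : ℂ :=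
  (p.1 : ℂ) ^ (a - 1) * (p.2 : ℂ) ^ (a + b - 1) *
    (Real.exp (-(p.2 * (p.1 * ‖x - y‖ ^ 2 + ‖y‖ ^ 2))) : ℝ)

lemma integral_rieszKernel_left {a b : ℂ} (ha : 0 < a.re) (hb : 0 < b.re) {x y : V}
    (hxy : x ≠ y) (hy : y ≠ 0)
    (h : Integrable (fun p => rieszKernel a b x p y)
      ((volume.restrict (Ioi 0)).prod (volume.restrict (Ioi 0)))) :
    ∫ p, rieszKernel a b x p y ∂((volume.restrict (Ioi 0)).prod (volume.restrict (Ioi 0))) =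
      Complex.Gamma a * Complex.Gamma b *
        ((‖x - y‖ : ℂ) ^ (-2 * a) * (‖y‖ : ℂ) ^ (-2 * b)) := by
  set μ : Measure ℝ := volume.restrict (Ioi 0) with hμ
  have hpos : ∀ᵐ t ∂μ, 0 < t := self_mem_ae_restrict measurableSet_Ioi
  have hA : 0 < ‖x - y‖ := norm_pos_iff.2 (sub_ne_zero.2 hxy)
  have hB : 0 < ‖y‖ := norm_pos_iff.2 hy
  rw [integral_prod_symm _ h]
  have : ∫ t, ∫ r, rieszKernel a b x (r, t) y ∂μ ∂μ =
      ∫ t, Complex.Gamma a * (‖x - y‖ : ℂ) ^ (-2 * a) * gammaKernel b (‖y‖ ^ 2) t ∂μ := by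
    refine integral_congr_ae ?_
    filter_upwards [hpos] with t ht
    have h1 : ∀ r, rieszKernel a b x (r, t) y =
        gammaKernel (a + b) (‖y‖ ^ 2) t * gammaKernel a (t * ‖x - y‖ ^ 2) r := by
      intro r
      have : (Real.exp (-(t * (r * ‖x - y‖ ^ 2 + ‖y‖ ^ 2))) : ℂ) =
          Complex.exp (-(((‖y‖ ^ 2 : ℝ) : ℂ) * t)) *
            Complex.exp (-(((t * ‖x - y‖ ^ 2 : ℝ) : ℂ) * r)) := by
        rw [← Complex.exp_add, Complex.ofReal_exp]; congr 1; push_cast; ring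
      simp only [rieszKernel, gammaKernel, this]
      ring
    have h2 : 0 < t * ‖x - y‖ ^ 2 := by positivity
    simp only [h1]
    rw [integral_const_mul, integral_gammaKernel ha h2]
    have h3 : gammaKernel (a + b) (‖y‖ ^ 2) t * ((1 / (t * ‖x - y‖ ^ 2) : ℝ) : ℂ) ^ a =
        (‖x - y‖ : ℂ) ^ (-2 * a) * gammaKernel b (‖y‖ ^ 2) t := by
      rw [gammaKernel, gammaKernel, Complex.ofReal_cpow_eq_exp_log_mul ht,
        Complex.ofReal_cpow_eq_exp_log_mul ht, Complex.ofReal_cpow_eq_exp_log_mul hA,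
        Complex.ofReal_cpow_eq_exp_log_mul (one_div_pos.2 h2), one_div, Real.log_inv,
        Real.log_mul ht.ne' (by positivity), Real.log_pow]
      simp only [← Complex.exp_add]
      congr 1
      push_cast
      ring
    rw [← mul_assoc, h3]
    ring
  rw [this, integral_const_mul, integral_gammaKernel hb (by positivity)]
  have h4 : ((1 / ‖y‖ ^ 2 : ℝ) : ℂ) ^ b = (‖y‖ : ℂ) ^ (-2 * b) := by
    rw [Complex.ofReal_cpow_eq_exp_log_mul hB,
        Complex.ofReal_cpow_eq_exp_log_mul (by positivity), one_div, Real.log_inv, Real.log_pow]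
    congr 1
    push_cast
    ring
  rw [h4]
  ring

variable [InnerProductSpace ℝ V] [FiniteDimensional ℝ V] [MeasurableSpace V] [BorelSpace V]

open Module

lemma integral_exp_neg_mul_sq_norm_sub_add_sq_norm (x : V) {r t : ℝ} (hr : 0 < r) (ht : 0 < t) :
    ∫ y : V, Real.exp (-(t * (r * ‖x - y‖ ^ 2 + ‖y‖ ^ 2))) =
      (Real.pi / (t * (1 + r))) ^ (finrank ℝ V / 2 : ℝ) *
        Real.exp (-(r / (1 + r) * ‖x‖ ^ 2 * t)) := by
  have h : ∀ y : V, Real.exp (-(t * (r * ‖x - y‖ ^ 2 + ‖y‖ ^ 2))) =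
      Real.exp (-(t * (1 + r)) * ‖y - (r / (1 + r)) • x‖ ^ 2) *
        Real.exp (-(r / (1 + r) * ‖x‖ ^ 2 * t)) := by
    intro y
    rw [← Real.exp_add, norm_sub_sq_real, norm_sub_sq_real, inner_smul_right, norm_smul, mul_pow,
      real_inner_comm, Real.norm_eq_abs, sq_abs]
    congr 1
    field_simp
    ring
  simp only [h]
  rw [integral_mul_const, integral_sub_right_eq_self
    (fun y : V => Real.exp (-(t * (1 + r)) * ‖y‖ ^ 2)),
    GaussianFourier.integral_rexp_neg_mul_sq_norm (by positivity)]

lemma integral_rieszKernel_of_pos (a b : ℂ) (x : V) {p : ℝ × ℝ} (h1 : 0 < p.1) (h2 : 0 < p.2) :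
    Integrable (rieszKernel a b x p) ∧
    ∫ y, rieszKernel a b x p y = (Real.pi : ℂ) ^ (finrank ℝ V / 2 : ℂ) *
        reducedKernel a b (finrank ℝ V / 2) (‖x‖ ^ 2) p ∧
    ∫ y, ‖rieszKernel a b x p y‖ = ‖(Real.pi : ℂ) ^ (finrank ℝ V / 2 : ℂ) *
        reducedKernel a b (finrank ℝ V / 2) (‖x‖ ^ 2) p‖ := by
  have h3 : 0 < 1 + p.1 := by positivity
  have hg := integral_exp_neg_mul_sq_norm_sub_add_sq_norm x h1 h2
  have hgi : Integrable fun y : V => Real.exp (-(p.2 * (p.1 * ‖x - y‖ ^ 2 + ‖y‖ ^ 2))) := by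
    refine .of_integral_ne_zero ?_
    rw [hg]
    positivity
  have key : (p.1 : ℂ) ^ (a - 1) * (p.2 : ℂ) ^ (a + b - 1) *
      (((Real.pi / (p.2 * (1 + p.1))) ^ (finrank ℝ V / 2 : ℝ) *
        Real.exp (-(p.1 / (1 + p.1) * ‖x‖ ^ 2 * p.2)) : ℝ) : ℂ) =
      (Real.pi : ℂ) ^ (finrank ℝ V / 2 : ℂ) *
        reducedKernel a b (finrank ℝ V / 2) (‖x‖ ^ 2) p := by
    have h4 : 0 < Real.pi / (p.2 * (1 + p.1)) := by positivity
    rw [reducedKernel, gammaKernel, Complex.ofReal_mul, Complex.ofReal_cpow h4.le,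
      Complex.ofReal_cpow_eq_exp_log_mul h1, Complex.ofReal_cpow_eq_exp_log_mul h2,
      Complex.ofReal_cpow_eq_exp_log_mul h2, Complex.ofReal_cpow_eq_exp_log_mul h3,
      Complex.ofReal_cpow_eq_exp_log_mul h4, Complex.ofReal_cpow_eq_exp_log_mul Real.pi_pos,
      Real.log_div Real.pi_pos.ne' (by positivity), Real.log_mul h2.ne' h3.ne',
      Complex.ofReal_exp]
    simp only [← Complex.exp_add]
    congr 1
    push_cast
    ring
  refine ⟨hgi.ofReal.const_mul _, ?_, ?_⟩
  · simp only [rieszKernel]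
    rw [integral_const_mul, integral_complex_ofReal, hg, key]
  · simp only [rieszKernel, norm_mul _ (Complex.ofReal _), Complex.norm_real,
      Real.norm_of_nonneg (Real.exp_pos _).le]
    rw [integral_const_mul, hg, ← key, norm_mul _ (Complex.ofReal _), Complex.norm_real,
      Real.norm_of_nonneg (by positivity)]

/-- The convolution of two Riesz kernels on a finite-dimensional Euclidean space. -/
theorem integrable_and_integral_norm_sub_cpow_mul_norm_cpow {a b : ℂ}
    (ha : 0 < a.re) (hb : 0 < b.re) (had : a.re < finrank ℝ V / 2) (hbd : b.re < finrank ℝ V / 2)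
    (hab : (finrank ℝ V / 2 : ℝ) < a.re + b.re) {x : V} (hx : x ≠ 0) :
    Integrable (fun y : V => (‖x - y‖ : ℂ) ^ (-2 * a) * (‖y‖ : ℂ) ^ (-2 * b)) ∧
    Complex.Gamma a * Complex.Gamma b *
        ∫ y : V, (‖x - y‖ : ℂ) ^ (-2 * a) * (‖y‖ : ℂ) ^ (-2 * b) =
      (Real.pi : ℂ) ^ (finrank ℝ V / 2 : ℂ) *
        (((‖x‖ ^ 2 : ℝ) : ℂ) ^ ((finrank ℝ V / 2 : ℂ) - a - b) *
          (Complex.Gamma (a + b - finrank ℝ V / 2) *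
            (Complex.Gamma (finrank ℝ V / 2 - b) * Complex.Gamma (finrank ℝ V / 2 - a) /
              Complex.Gamma (2 * (finrank ℝ V / 2 : ℂ) - a - b)))) := by
  have : Nontrivial V := ⟨x, 0, hx⟩
  set μ : Measure ℝ := volume.restrict (Ioi 0) with hμ
  have hdre : (finrank ℝ V / 2 : ℂ).re = (finrank ℝ V / 2 : ℝ) := by
    rw [← Complex.ofReal_re (finrank ℝ V / 2 : ℝ)]; push_cast; rfl
  have hX : 0 < ‖x‖ ^ 2 := by have := norm_pos_iff.2 hx; positivity
  rw [← hdre] at had hbd hab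
  obtain ⟨hi, hI⟩ := integrable_and_integral_reducedKernel had hbd hab hX
  have hpos : ∀ᵐ p ∂μ.prod μ, 0 < p.1 ∧ 0 < p.2 := by
    rw [hμ, Measure.prod_restrict]
    exact self_mem_ae_restrict (measurableSet_Ioi.prod measurableSet_Ioi)
  have hm : Measurable (Function.uncurry (rieszKernel a b x)) := by
    unfold Function.uncurry rieszKernel
    fun_prop
  have hF : Integrable (Function.uncurry (rieszKernel a b x)) ((μ.prod μ).prod volume) := by
    rw [integrable_prod_iff hm.aestronglyMeasurable]
    constructor
    · filter_upwards [hpos] with p hp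
      exact (integral_rieszKernel_of_pos a b x hp.1 hp.2).1
    · refine (hi.const_mul ((Real.pi : ℂ) ^ (finrank ℝ V / 2 : ℂ))).norm.congr ?_
      filter_upwards [hpos] with p hp
      exact (integral_rieszKernel_of_pos a b x hp.1 hp.2).2.2.symm
  have hsec : (fun y => ∫ p, rieszKernel a b x p y ∂μ.prod μ) =ᵐ[volume] fun y =>
      Complex.Gamma a * Complex.Gamma b *
        ((‖x - y‖ : ℂ) ^ (-2 * a) * (‖y‖ : ℂ) ^ (-2 * b)) := by
    filter_upwards [hF.prod_left_ae, Measure.ae_ne volume x, Measure.ae_ne volume 0]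
      with y hy hyx hy0
    exact integral_rieszKernel_left ha hb hyx.symm hy0 hy
  have hΓ : Complex.Gamma a * Complex.Gamma b ≠ 0 :=
    mul_ne_zero (Complex.Gamma_ne_zero_of_re_pos ha) (Complex.Gamma_ne_zero_of_re_pos hb)
  constructor
  · have := (hF.integral_prod_right.congr hsec).const_mul (Complex.Gamma a * Complex.Gamma b)⁻¹
    simpa only [inv_mul_cancel_left₀ hΓ] using this
  · rw [← integral_const_mul, ← integral_congr_ae hsec, ← integral_integral_swap hF, ← hI,
      ← integral_const_mul]
    refine integral_congr_ae ?_
    filter_upwards [hpos] with p hp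
    exact (integral_rieszKernel_of_pos a b x hp.1 hp.2).2.1

end Riesz

theorem convolution_Tstar_Tstar
    (m : ℕ) (hm : 1 ≤ m) (α β : ℂ)
    (hα : -(m : ℝ) < α.re) (hβ : -(m : ℝ) < β.re) (hαβ : (α + β).re < -(m : ℝ))
    (x : EuclideanSpace ℝ (Fin m)) (hx : x ≠ 0) :
    Integrable (fun y : EuclideanSpace ℝ (Fin m) =>
      ((‖x - y‖ : ℂ) ^ α) * ((‖y‖ : ℂ) ^ β)) ∧
    ∫ y : EuclideanSpace ℝ (Fin m), ((‖x - y‖ : ℂ) ^ α) * ((‖y‖ : ℂ) ^ β) =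
      (Real.pi : ℂ) ^ ((m : ℂ) / 2) *
        (Complex.Gamma ((α + m) / 2) * Complex.Gamma ((β + m) / 2) *
          Complex.Gamma (-(α + β + m) / 2) /
        (Complex.Gamma (-α / 2) * Complex.Gamma (-β / 2) *
          Complex.Gamma ((α + β + 2 * m) / 2))) *
      (‖x‖ : ℂ) ^ (α + β + m) := by
  have hx0 : 0 < ‖x‖ := norm_pos_iff.2 hx
  have hre : ∀ z : ℂ, (-z / 2).re = -z.re / 2 := fun z => by
    rw [Complex.div_ofNat_re, Complex.neg_re]
  rw [Complex.add_re] at hαβ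
  have ha : 0 < (-α / 2).re := by rw [hre]; linarith
  have hb : 0 < (-β / 2).re := by rw [hre]; linarith
  have h := integrable_and_integral_norm_sub_cpow_mul_norm_cpow (V := EuclideanSpace ℝ (Fin m))
    ha hb (by rw [hre, finrank_euclideanSpace_fin]; linarith)
    (by rw [hre, finrank_euclideanSpace_fin]; linarith)
    (by rw [hre, hre, finrank_euclideanSpace_fin]; linarith) hx
  rw [finrank_euclideanSpace_fin, show -2 * (-α / 2) = α by ring,
    show -2 * (-β / 2) = β by ring] at h
  refine ⟨h.1, ?_⟩
  have hΓa := Complex.Gamma_ne_zero_of_re_pos ha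
  have hΓb := Complex.Gamma_ne_zero_of_re_pos hb
  have hpow : ((‖x‖ ^ 2 : ℝ) : ℂ) ^ ((m / 2 : ℂ) - -α / 2 - -β / 2) =
      (‖x‖ : ℂ) ^ (α + β + m) := by
    rw [Complex.ofReal_cpow_eq_exp_log_mul hx0,
      Complex.ofReal_cpow_eq_exp_log_mul (by positivity), Real.log_pow]
    congr 1
    push_cast
    ring
  rw [← mul_right_inj' (mul_ne_zero hΓa hΓb), h.2, hpow,
    show -α / 2 + -β / 2 - m / 2 = -(α + β + m) / 2 by ring,
    show (m / 2 : ℂ) - -β / 2 = (β + m) / 2 by ring,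
    show (m / 2 : ℂ) - -α / 2 = (α + m) / 2 by ring,
    show 2 * (m / 2 : ℂ) - -α / 2 - -β / 2 = (α + β + 2 * m) / 2 by ring]
  generalize Complex.Gamma (-α / 2) = A at hΓa ⊢
  generalize Complex.Gamma (-β / 2) = B at hΓb ⊢
  field_simp
end

section
/- Let m ≥ 2 be an integer. For every Schwartz function φ on ℝ^{1+m}, the function X ↦ |X|^{-(m-1)} Δφ(X) is integrable on ℝ^{1+m} and -(1/((m-1)σ_{m+1})) ∫_{ℝ^{1+m}} |X|^{-(m-1)} Δφ(X) dX = φ(0), where Δφ denotes the sum of all second partial derivatives of φ. (This expresses that ½A_0(X) = -(1/((m-1)σ_{m+1})) |X|^{-(m-1)} is the fundamental solution (Green's function) of the Laplace operator Δ_{m+1} in ℝ^{m+1}.) -/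
open MeasureTheory

/-- The area of the unit sphere `S^{n-1}` in `ℝ^n`: `σ_n = 2 π^{n/2} / Γ(n/2)`. -/
noncomputable def sphereArea (n : ℕ) : ℝ :=
  2 * Real.pi ^ ((n : ℝ) / 2) / Real.Gamma ((n : ℝ) / 2)

/-- The Laplacian on `ℝ^{1+m}`, as the sum of all second partial derivatives. -/
noncomputable def laplacian (m : ℕ) (f : EuclideanSpace ℝ (Fin (1 + m)) → ℝ)
    (X : EuclideanSpace ℝ (Fin (1 + m))) : ℝ :=
  ∑ i : Fin (1 + m),
    fderiv ℝ (fun Y => fderiv ℝ f Y (EuclideanSpace.single i (1 : ℝ))) X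
      (EuclideanSpace.single i (1 : ℝ))

open Filter Set Module
open scoped Topology SchwartzMap LineDeriv RealInnerProductSpace

lemma norm_norm_sq_add_rpow_le {E : Type*} [NormedAddCommGroup E] {ε a : ℝ} (hε : 0 < ε)
    (ha : a ≤ 0) (x : E) :
    ‖(‖x‖ ^ 2 + ε) ^ a‖ ≤ ε ^ a := by
  rw [Real.norm_of_nonneg (by positivity)]
  exact Real.rpow_le_rpow_of_nonpos hε (by nlinarith [sq_nonneg ‖x‖]) ha

section Regularized

variable {E : Type*} [NormedAddCommGroup E] [InnerProductSpace ℝ E]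

lemma hasFDerivAt_norm_sq_add_rpow {ε : ℝ} (hε : 0 < ε) (a : ℝ) (x : E) :
    HasFDerivAt (fun y : E => (‖y‖ ^ 2 + ε) ^ a)
      ((2 * a * (‖x‖ ^ 2 + ε) ^ (a - 1)) • innerSL ℝ x) x := by
  have h : HasFDerivAt (fun y : E => ‖y‖ ^ 2 + ε) (2 • innerSL ℝ x) x :=
    (hasStrictFDerivAt_norm_sq x).hasFDerivAt.add_const ε
  have hx : ‖x‖ ^ 2 + ε ≠ 0 := by positivity
  convert! h.rpow_const (p := a) (Or.inl hx) using 1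
  ext v
  simp
  ring

lemma continuous_norm_sq_add_rpow {ε : ℝ} (hε : 0 < ε) (a : ℝ) :
    Continuous fun x : E => (‖x‖ ^ 2 + ε) ^ a :=
  continuous_iff_continuousAt.2 fun x => (hasFDerivAt_norm_sq_add_rpow hε a x).continuousAt

variable [FiniteDimensional ℝ E] [MeasurableSpace E] [BorelSpace E]

lemma integrable_norm_sq_add_rpow_mul {ε a : ℝ} (hε : 0 < ε) (ha : a ≤ 0) {f : E → ℝ}
    (hf : Integrable f) : Integrable fun x : E => (‖x‖ ^ 2 + ε) ^ a * f x :=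
  hf.bdd_mul (continuous_norm_sq_add_rpow hε a).aestronglyMeasurable
    (ae_of_all _ (norm_norm_sq_add_rpow_le hε ha))

lemma SchwartzMap.integrable_inner_pow_mul (ψ : 𝓢(E, ℝ)) (v : E) (k : ℕ) :
    Integrable fun x : E => ⟪x, v⟫ ^ k * ψ x := by
  refine ((ψ.integrable_pow_mul volume k).const_mul (‖v‖ ^ k)).mono'
    (Continuous.aestronglyMeasurable (by fun_prop)) (ae_of_all _ fun x => ?_)
  rw [norm_mul, norm_pow]
  calc ‖⟪x, v⟫‖ ^ k * ‖ψ x‖ ≤ (‖x‖ * ‖v‖) ^ k * ‖ψ x‖ := by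
        gcongr; exact norm_inner_le_norm x v
    _ = _ := by ring

/-- Integrating by parts twice against a power of `‖x‖ ^ 2 + ε`. -/
lemma integral_norm_sq_add_rpow_mul_lineDerivOp {ε a : ℝ} (hε : 0 < ε) (ha : a ≤ 0) (v : E)
    (φ : 𝓢(E, ℝ)) :
    ∫ x, (‖x‖ ^ 2 + ε) ^ a * (∂_{v} (∂_{v} φ)) x =
      ∫ x, (2 * a * ‖v‖ ^ 2 * ((‖x‖ ^ 2 + ε) ^ (a - 1) * φ x) +
        4 * a * (a - 1) * ((‖x‖ ^ 2 + ε) ^ (a - 2) * (⟪x, v⟫ ^ 2 * φ x))) := by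
  have hint (ψ : 𝓢(E, ℝ)) (k : ℕ) {b : ℝ} (hb : b ≤ 0) :
      Integrable fun x => (‖x‖ ^ 2 + ε) ^ b * (⟪x, v⟫ ^ k * ψ x) :=
    integrable_norm_sq_add_rpow_mul hε hb (ψ.integrable_inner_pow_mul v k)
  have hint' (ψ : 𝓢(E, ℝ)) {b : ℝ} (hb : b ≤ 0) : Integrable fun x => (‖x‖ ^ 2 + ε) ^ b * ψ x :=
    integrable_norm_sq_add_rpow_mul hε hb ψ.integrable
  have hd (x : E) : HasFDerivAt (fun y => 2 * a * ((‖y‖ ^ 2 + ε) ^ (a - 1) * ⟪y, v⟫))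
      ((2 * a) • ((‖x‖ ^ 2 + ε) ^ (a - 1) • innerSL ℝ v +
        ⟪x, v⟫ • ((2 * (a - 1) * (‖x‖ ^ 2 + ε) ^ (a - 1 - 1)) • innerSL ℝ x))) x := by
    refine ((hasFDerivAt_norm_sq_add_rpow hε (a - 1) x).mul ?_).const_mul _
    exact (innerSL ℝ v).hasFDerivAt.congr_of_eventuallyEq
      (Eventually.of_forall fun y => real_inner_comm v y)
  have e1 := integral_bilinear_hasFDerivAt_right_eq_neg_left_of_integrable (μ := volume)
    (B := ContinuousLinearMap.mul ℝ ℝ) (v := v)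
    (f := fun x : E => (‖x‖ ^ 2 + ε) ^ a) (g := ⇑(∂_{v} φ : 𝓢(E, ℝ)))
    (((hint (∂_{v} φ) 1 (by linarith : a - 1 ≤ 0)).const_mul (2 * a)).congr
      (ae_of_all _ fun x => by simp; ring))
    (hint' (∂_{v} (∂_{v} φ)) ha) (hint' (∂_{v} φ) ha)
    (fun x _ => hasFDerivAt_norm_sq_add_rpow hε a x) (fun x _ => (∂_{v} φ).hasFDerivAt x)
  have e2 := integral_bilinear_hasFDerivAt_right_eq_neg_left_of_integrable (μ := volume)
    (B := ContinuousLinearMap.mul ℝ ℝ) (v := v)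
    (f := fun x : E => 2 * a * ((‖x‖ ^ 2 + ε) ^ (a - 1) * ⟪x, v⟫)) (g := ⇑φ)
    ((((hint' φ (by linarith : a - 1 ≤ 0)).const_mul (2 * a * ‖v‖ ^ 2)).add
      ((hint φ 2 (by linarith : a - 1 - 1 ≤ 0)).const_mul (4 * a * (a - 1)))).congr
      (ae_of_all _ fun x => by simp; ring))
    (((hint (∂_{v} φ) 1 (by linarith : a - 1 ≤ 0)).const_mul (2 * a)).congr
      (ae_of_all _ fun x => by simp [SchwartzMap.lineDerivOp_apply_eq_fderiv]; ring))
    (((hint φ 1 (by linarith : a - 1 ≤ 0)).const_mul (2 * a)).congr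
      (ae_of_all _ fun x => by simp; ring))
    (fun x _ => hd x) (fun x _ => φ.hasFDerivAt x)
  calc _ = -∫ x, 2 * a * ((‖x‖ ^ 2 + ε) ^ (a - 1) * ⟪x, v⟫) * fderiv ℝ φ x v := by
        refine Eq.trans e1 (congrArg _ (integral_congr_ae (ae_of_all _ fun x => ?_)))
        simp [SchwartzMap.lineDerivOp_apply_eq_fderiv]; left; ring
    _ = _ := by
        rw [neg_eq_iff_eq_neg]
        refine Eq.trans e2 (congrArg _ (integral_congr_ae (ae_of_all _ fun x => ?_)))
        simp [show a - 1 - 1 = a - 2 by ring]; ring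

/-- The Newtonian kernel is integrable against Schwartz functions. -/
lemma SchwartzMap.integrable_div_norm_pow (hE : 2 ≤ finrank ℝ E) (ψ : 𝓢(E, ℝ)) :
    Integrable fun x : E => ψ x / ‖x‖ ^ (finrank ℝ E - 2) := by
  have : Nontrivial E := Module.nontrivial_of_finrank_pos (R := ℝ) (by omega)
  obtain ⟨C, hC⟩ : ∃ C : ℝ, ∀ x, (1 + ‖x‖) ^ 4 * ‖ψ x‖ ≤ C :=
    ⟨_, fun x => by
      simpa using SchwartzMap.one_add_le_sup_seminorm_apply (𝕜 := ℝ) (m := (4, 0)) le_rfl le_rfl ψ x⟩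
  have hrad : Integrable fun x : E => (fun r : ℝ => ((1 + r) ^ 4 * r ^ (finrank ℝ E - 2))⁻¹) ‖x‖ := by
    rw [integrable_fun_norm_addHaar volume
      (f := fun r : ℝ => ((1 + r) ^ 4 * r ^ (finrank ℝ E - 2))⁻¹)]
    refine integrable_inv_one_add_sq.integrableOn.mono'
      (Measurable.aestronglyMeasurable (by fun_prop)) ?_
    filter_upwards [ae_restrict_mem measurableSet_Ioi] with r (hr : 0 < r)
    have : finrank ℝ E - 1 = finrank ℝ E - 2 + 1 := by omega
    rw [this, smul_eq_mul, Real.norm_of_nonneg (by positivity), pow_succ, ← div_eq_mul_inv,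
      ← one_div, div_le_div_iff₀ (by positivity) (by positivity)]
    have : r * (1 + r ^ 2) ≤ (1 + r) ^ 4 := by nlinarith [pow_pos hr 2, pow_pos hr 3, pow_pos hr 4]
    have := mul_le_mul_of_nonneg_left this (pow_nonneg hr.le (finrank ℝ E - 2))
    linarith
  refine (hrad.const_mul C).mono' (Measurable.aestronglyMeasurable (by fun_prop))
    (ae_of_all _ fun x => ?_)
  dsimp only
  rw [norm_div, norm_pow, norm_norm, mul_inv, ← mul_assoc, ← div_eq_mul_inv, ← div_eq_mul_inv]
  gcongr
  rw [le_div_iff₀ (by positivity), mul_comm]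
  exact hC x

lemma integral_Ioi_pow_mul_one_add_sq_rpow {n : ℕ} (hn : 0 < n) :
    ∫ r in Ioi (0 : ℝ), r ^ (n - 1) * (r ^ 2 + 1) ^ (-((n : ℝ) + 2) / 2) = 1 / (n : ℝ) := by
  have hn' : (n : ℝ) ≠ 0 := by positivity
  have hderiv (r : ℝ) : HasDerivAt (fun r : ℝ => r ^ n * (r ^ 2 + 1) ^ (-(n : ℝ) / 2) / n)
      (r ^ (n - 1) * (r ^ 2 + 1) ^ (-((n : ℝ) + 2) / 2)) r := by
    have hpos : 0 < r ^ 2 + 1 := by positivity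
    have h1 : HasDerivAt (fun r : ℝ => r ^ 2 + 1) (2 * r) r := by
      simpa using (hasDerivAt_pow 2 r).add_const 1
    convert! ((hasDerivAt_pow n r).mul (h1.rpow_const (p := -(n : ℝ) / 2)
      (Or.inl hpos.ne'))).div_const (n : ℝ) using 1
    obtain ⟨k, rfl⟩ : ∃ k, n = k + 1 := ⟨n - 1, by omega⟩
    have e : (-((k + 1 : ℕ) : ℝ) / 2) = -(((k + 1 : ℕ) : ℝ) + 2) / 2 + 1 := by ring
    rw [e, add_sub_cancel_right, Real.rpow_add_one hpos.ne']
    field_simp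
    simp only [Nat.add_sub_cancel]
    push_cast
    ring
  have hlim : Tendsto (fun r : ℝ => r ^ n * (r ^ 2 + 1) ^ (-(n : ℝ) / 2) / n) atTop
      (𝓝 (1 / (n : ℝ))) := by
    have h0 : Tendsto (fun r : ℝ => (1 + (r ^ 2)⁻¹) ^ (-(n : ℝ) / 2) / n) atTop
        (𝓝 (1 / (n : ℝ))) := by
      have h1 : Tendsto (fun r : ℝ => 1 + (r ^ 2)⁻¹) atTop (𝓝 1) := by
        simpa using (tendsto_inv_atTop_zero.comp
          (tendsto_pow_atTop (α := ℝ) two_ne_zero)).const_add 1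
      simpa using (h1.rpow_const (p := -(n : ℝ) / 2) (Or.inl one_ne_zero)).div_const (n : ℝ)
    refine h0.congr' ?_
    filter_upwards [eventually_gt_atTop 0] with r hr
    have e : r ^ 2 + 1 = r ^ 2 * (1 + (r ^ 2)⁻¹) := by field_simp
    rw [e, Real.mul_rpow (by positivity) (by positivity), ← mul_assoc,
      ← Real.rpow_natCast r 2, ← Real.rpow_mul hr.le, ← Real.rpow_natCast r n,
      ← Real.rpow_add hr]
    simp [show (n : ℝ) + 2 * (-n / 2) = 0 by ring]
  rw [integral_Ioi_of_hasDerivAt_of_nonneg' (fun r _ => hderiv r) (fun r hr => ?_) hlim]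
  · simp [hn.ne']
  · have : (0 : ℝ) < r := hr
    positivity

lemma integral_norm_sq_add_one_rpow [Nontrivial E] :
    ∫ x : E, (‖x‖ ^ 2 + 1) ^ (-((finrank ℝ E : ℝ) + 2) / 2) =
      volume.real (Metric.ball (0 : E) 1) := by
  have hn : 0 < finrank ℝ E := finrank_pos
  rw [integral_fun_norm_addHaar volume
    (fun r : ℝ => (r ^ 2 + 1) ^ (-((finrank ℝ E : ℝ) + 2) / 2))]
  simp only [smul_eq_mul, nsmul_eq_mul]
  rw [integral_Ioi_pow_mul_one_add_sq_rpow hn]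
  field_simp

lemma integrable_norm_sq_add_one_rpow :
    Integrable fun x : E => (‖x‖ ^ 2 + 1) ^ (-((finrank ℝ E : ℝ) + 2) / 2) := by
  simpa only [add_comm] using
    integrable_rpow_neg_one_add_norm_sq (μ := (volume : Measure E))
      (r := (finrank ℝ E : ℝ) + 2) (by linarith)

lemma sq_mul_integral_norm_sq_add_sq_rpow_mul {δ : ℝ} (hδ : 0 < δ) (f : E → ℝ) :
    δ ^ 2 * ∫ x : E, (‖x‖ ^ 2 + δ ^ 2) ^ (-((finrank ℝ E : ℝ) + 2) / 2) * f x =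
      ∫ x : E, (‖x‖ ^ 2 + 1) ^ (-((finrank ℝ E : ℝ) + 2) / 2) * f (δ • x) := by
  have h := Measure.integral_comp_smul_of_nonneg (volume : Measure E)
    (fun x : E => (‖x‖ ^ 2 + δ ^ 2) ^ (-((finrank ℝ E : ℝ) + 2) / 2) * f x) δ (hR := hδ.le)
  have e (x : E) : (‖δ • x‖ ^ 2 + δ ^ 2) ^ (-((finrank ℝ E : ℝ) + 2) / 2) * f (δ • x) =
      (δ ^ (finrank ℝ E + 2))⁻¹ *
        ((‖x‖ ^ 2 + 1) ^ (-((finrank ℝ E : ℝ) + 2) / 2) * f (δ • x)) := by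
    rw [norm_smul, Real.norm_of_nonneg hδ.le,
      show (δ * ‖x‖) ^ 2 + δ ^ 2 = δ ^ 2 * (‖x‖ ^ 2 + 1) by ring,
      Real.mul_rpow (by positivity) (by positivity), ← Real.rpow_natCast δ 2,
      ← Real.rpow_mul hδ.le, ← Real.rpow_natCast δ (_ + 2), ← Real.rpow_neg hδ.le, mul_assoc]
    congr 2
    push_cast
    ring
  simp only [e, integral_const_mul, smul_eq_mul] at h
  rw [pow_add, mul_inv, mul_assoc] at h
  rw [← mul_left_cancel₀ (inv_ne_zero (pow_pos hδ _).ne') h, mul_inv_cancel_left₀ (by positivity)]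

lemma tendsto_sq_mul_integral_norm_sq_add_sq_rpow_mul [Nontrivial E] (φ : 𝓢(E, ℝ)) :
    Tendsto (fun δ : ℝ => δ ^ 2 *
        ∫ x : E, (‖x‖ ^ 2 + δ ^ 2) ^ (-((finrank ℝ E : ℝ) + 2) / 2) * φ x)
      (𝓝[>] 0) (𝓝 (volume.real (Metric.ball (0 : E) 1) * φ 0)) := by
  obtain ⟨C, hC⟩ : ∃ C : ℝ, ∀ x, ‖φ x‖ ≤ C :=
    ⟨_, fun x => by simpa using SchwartzMap.le_seminorm ℝ 0 0 φ x⟩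
  rw [← integral_norm_sq_add_one_rpow, ← integral_mul_const]
  have h : Tendsto (fun δ : ℝ =>
      ∫ x : E, (‖x‖ ^ 2 + 1) ^ (-((finrank ℝ E : ℝ) + 2) / 2) * φ (δ • x)) (𝓝[>] 0)
      (𝓝 (∫ x : E, (‖x‖ ^ 2 + 1) ^ (-((finrank ℝ E : ℝ) + 2) / 2) * φ 0)) := by
    refine tendsto_integral_filter_of_dominated_convergence _
      (Eventually.of_forall fun δ => ((continuous_norm_sq_add_rpow one_pos _).mul
        (φ.continuous.comp (continuous_const_smul δ))).aestronglyMeasurable)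
      (Eventually.of_forall fun δ => ae_of_all _ fun x => ?_)
      ((integrable_norm_sq_add_one_rpow (E := E)).mul_const C) (ae_of_all _ fun x => ?_)
    · rw [norm_mul, Real.norm_of_nonneg (by positivity)]
      gcongr
      exact hC _
    · refine Tendsto.const_mul _ (Tendsto.mono_left ?_ nhdsWithin_le_nhds)
      have : Continuous fun δ : ℝ => φ (δ • x) := by fun_prop
      simpa using this.tendsto 0
  refine h.congr' ?_
  filter_upwards [self_mem_nhdsWithin] with δ hδ
  exact (sq_mul_integral_norm_sq_add_sq_rpow_mul hδ φ).symm

/-- The regularized kernels converge to the Newtonian kernel. -/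
lemma tendsto_integral_norm_sq_add_sq_rpow_mul (hE : 2 ≤ finrank ℝ E) (ψ : 𝓢(E, ℝ)) :
    Tendsto (fun δ : ℝ => ∫ x : E, (‖x‖ ^ 2 + δ ^ 2) ^ (-((finrank ℝ E : ℝ) - 2) / 2) * ψ x)
      (𝓝[>] 0) (𝓝 (∫ x : E, ψ x / ‖x‖ ^ (finrank ℝ E - 2))) := by
  have : Nontrivial E := Module.nontrivial_of_finrank_pos (R := ℝ) (by omega)
  have hE' : (2 : ℝ) ≤ finrank ℝ E := by exact_mod_cast hE
  have hne : ∀ᵐ x : E, x ≠ 0 := by simp [ae_iff]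
  have e {x : E} (hx : x ≠ 0) :
      (‖x‖ ^ 2) ^ (-((finrank ℝ E : ℝ) - 2) / 2) = (‖x‖ ^ (finrank ℝ E - 2))⁻¹ := by
    rw [← Real.rpow_natCast ‖x‖ 2, ← Real.rpow_mul (norm_nonneg x),
      ← Real.rpow_natCast ‖x‖ (_ - 2), ← Real.rpow_neg (norm_nonneg x)]
    congr 1
    push_cast [Nat.cast_sub hE]
    ring
  refine tendsto_integral_filter_of_dominated_convergence _ ?_ ?_
    (ψ.integrable_div_norm_pow hE).norm ?_
  · filter_upwards [self_mem_nhdsWithin] with δ (hδ : 0 < δ)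
    exact ((continuous_norm_sq_add_rpow (pow_pos hδ 2) _).mul ψ.continuous).aestronglyMeasurable
  · filter_upwards [self_mem_nhdsWithin] with δ (hδ : 0 < δ)
    filter_upwards [hne] with x hx
    rw [norm_mul, norm_div, norm_pow, norm_norm, div_eq_inv_mul ‖ψ x‖, ← e hx,
      Real.norm_of_nonneg (by positivity)]
    gcongr ?_ * _
    exact Real.rpow_le_rpow_of_nonpos (by positivity) (by nlinarith [sq_nonneg δ]) (by linarith)
  · filter_upwards [hne] with x hx
    rw [div_eq_inv_mul (ψ x), ← e hx]
    refine Tendsto.mul_const _ (Tendsto.rpow_const (Tendsto.mono_left ?_ nhdsWithin_le_nhds)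
      (Or.inl (by positivity)))
    have : Continuous fun δ : ℝ => ‖x‖ ^ 2 + δ ^ 2 := by fun_prop
    simpa using this.tendsto 0

end Regularized

section Euclidean

variable {d : ℕ}

lemma integral_norm_sq_add_rpow_mul_sum_lineDerivOp {ε : ℝ} (hε : 0 < ε) (hd : 2 ≤ d)
    (φ : 𝓢(EuclideanSpace ℝ (Fin d), ℝ)) :
    ∫ x : EuclideanSpace ℝ (Fin d), (‖x‖ ^ 2 + ε) ^ (-((d : ℝ) - 2) / 2) *
        (∑ i : Fin d, ∂_{EuclideanSpace.single i (1 : ℝ)} (∂_{EuclideanSpace.single i (1 : ℝ)} φ) :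
          𝓢(EuclideanSpace ℝ (Fin d), ℝ)) x =
      -(d * (d - 2) * (ε * ∫ x : EuclideanSpace ℝ (Fin d),
        (‖x‖ ^ 2 + ε) ^ (-((d : ℝ) + 2) / 2) * φ x)) := by
  set a : ℝ := -((d : ℝ) - 2) / 2 with ha_def
  have ha : a ≤ 0 := by
    have : (2 : ℝ) ≤ d := by exact_mod_cast hd
    linarith
  have hsum (x : EuclideanSpace ℝ (Fin d)) :
      (‖x‖ ^ 2 + ε) ^ a *
        (∑ i : Fin d, ∂_{EuclideanSpace.single i (1 : ℝ)} (∂_{EuclideanSpace.single i (1 : ℝ)} φ) :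
          𝓢(EuclideanSpace ℝ (Fin d), ℝ)) x =
      ∑ i : Fin d, (‖x‖ ^ 2 + ε) ^ a *
        (∂_{EuclideanSpace.single i (1 : ℝ)} (∂_{EuclideanSpace.single i (1 : ℝ)} φ)) x := by
    rw [sum_apply, Finset.mul_sum]
  simp_rw [hsum]
  rw [integral_finsetSum _ fun i _ => integrable_norm_sq_add_rpow_mul hε ha
    (SchwartzMap.integrable _)]
  simp_rw [integral_norm_sq_add_rpow_mul_lineDerivOp hε ha]
  rw [← integral_finsetSum]
  swap
  · exact fun i _ => ((integrable_norm_sq_add_rpow_mul hε (by linarith)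
      φ.integrable).const_mul _).add ((integrable_norm_sq_add_rpow_mul hε (by linarith)
      (φ.integrable_inner_pow_mul _ 2)).const_mul _)
  rw [← integral_const_mul, ← integral_const_mul, ← integral_neg]
  congr 1
  ext x
  have hpos : 0 < ‖x‖ ^ 2 + ε := by positivity
  have hx : ∑ i, x i ^ 2 = ‖x‖ ^ 2 := (EuclideanSpace.real_norm_sq_eq x).symm
  have h1 : a - 1 = -((d : ℝ) + 2) / 2 + 1 := by rw [ha_def]; ring
  have h2 : a - 2 = -((d : ℝ) + 2) / 2 := by rw [ha_def]; ring
  rw [Finset.sum_add_distrib, ← Finset.mul_sum, ← Finset.mul_sum, ← Finset.sum_mul,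
    ← Finset.sum_mul]
  simp only [EuclideanSpace.inner_single_right, PiLp.norm_single, norm_one, one_pow,
    mul_one, one_mul, conj_trivial, hx, Finset.sum_const, Finset.card_univ, Fintype.card_fin,
    nsmul_eq_mul]
  rw [h1, h2, Real.rpow_add_one hpos.ne', ha_def]
  ring

lemma laplacian_eq_sum_lineDerivOp (m : ℕ) (φ : 𝓢(EuclideanSpace ℝ (Fin (1 + m)), ℝ))
    (x : EuclideanSpace ℝ (Fin (1 + m))) :
    laplacian m (fun y => φ y) x =
      (∑ i : Fin (1 + m), ∂_{EuclideanSpace.single i (1 : ℝ)}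
        (∂_{EuclideanSpace.single i (1 : ℝ)} φ) :
          𝓢(EuclideanSpace ℝ (Fin (1 + m)), ℝ)) x := by
  rw [sum_apply]
  rfl

lemma sphereArea_eq_mul_volume_ball (hd : 0 < d) :
    sphereArea d = d * volume.real (Metric.ball (0 : EuclideanSpace ℝ (Fin d)) 1) := by
  have : Nonempty (Fin d) := ⟨⟨0, hd⟩⟩
  have hd' : (0 : ℝ) < d := by exact_mod_cast hd
  have hG : 0 < Real.Gamma ((d : ℝ) / 2) := Real.Gamma_pos_of_pos (by positivity)
  rw [Measure.real, EuclideanSpace.volume_ball, Fintype.card_fin, ENNReal.ofReal_one, one_pow,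
    one_mul, Real.Gamma_add_one (by positivity), ENNReal.toReal_ofReal (by positivity), sphereArea,
    Real.sqrt_eq_rpow, ← Real.rpow_mul_natCast Real.pi_pos.le, one_div_mul_eq_div]
  field_simp

end Euclidean

theorem green_function_fundamental_solution_laplacian
    (m : ℕ) (hm : 2 ≤ m) (φ : SchwartzMap (EuclideanSpace ℝ (Fin (1 + m))) ℝ) :
    Integrable (fun X : EuclideanSpace ℝ (Fin (1 + m)) =>
      laplacian m (fun Y => φ Y) X / ‖X‖ ^ (m - 1)) ∧
    -(1 / (((m : ℝ) - 1) * sphereArea (m + 1))) *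
        ∫ X : EuclideanSpace ℝ (Fin (1 + m)),
          laplacian m (fun Y => φ Y) X / ‖X‖ ^ (m - 1) = φ 0 := by
  have hrank : finrank ℝ (EuclideanSpace ℝ (Fin (1 + m))) = 1 + m := by simp
  have hrank2 : 2 ≤ finrank ℝ (EuclideanSpace ℝ (Fin (1 + m))) := by omega
  have : Nontrivial (EuclideanSpace ℝ (Fin (1 + m))) :=
    Module.nontrivial_of_finrank_pos (R := ℝ) (by omega)
  simp_rw [laplacian_eq_sum_lineDerivOp]
  set ψ : 𝓢(EuclideanSpace ℝ (Fin (1 + m)), ℝ) := ∑ i : Fin (1 + m),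
    ∂_{EuclideanSpace.single i (1 : ℝ)} (∂_{EuclideanSpace.single i (1 : ℝ)} φ)
  have hexp : 1 + m - 2 = m - 1 := by omega
  have hint := ψ.integrable_div_norm_pow hrank2
  have hleft := tendsto_integral_norm_sq_add_sq_rpow_mul hrank2 ψ
  have hright := ((tendsto_sq_mul_integral_norm_sq_add_sq_rpow_mul φ).const_mul
    (((1 + m : ℕ) : ℝ) * (((1 + m : ℕ) : ℝ) - 2))).neg
  rw [hrank, hexp] at hint hleft
  rw [hrank] at hright
  refine ⟨hint, ?_⟩
  have hlim := tendsto_nhds_unique (hleft.congr' (by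
    filter_upwards [self_mem_nhdsWithin] with δ (hδ : 0 < δ)
    exact integral_norm_sq_add_rpow_mul_sum_lineDerivOp (pow_pos hδ 2) (by omega) φ)) hright
  have hball : 0 < volume.real (Metric.ball (0 : EuclideanSpace ℝ (Fin (1 + m))) 1) :=
    ENNReal.toReal_pos (Metric.measure_ball_pos _ _ one_pos).ne' measure_ball_lt_top.ne
  have hm1 : (0 : ℝ) < m - 1 := by
    have : (2 : ℝ) ≤ m := by exact_mod_cast hm
    linarith
  have hm2 : (0 : ℝ) < 1 + m := by positivity
  rw [hlim, add_comm m 1, sphereArea_eq_mul_volume_ball (by omega)]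
  push_cast
  rw [show (1 + (m : ℝ) - 2) = m - 1 by ring]
  field_simp
end

section
/- Let m ≥ 2 be an integer. For every x ∈ ℝ^m with x ≠ 0 and every j ∈ {1,…,m}, the principal value convolution of the Hilbert kernel H(y) = -(2/σ_{m+1}) y/|y|^{m+1} with the function a_0(y) = -(2/((m-1)σ_{m+1})) |y|^{-(m-1)} exists componentwise and equals b_0: (4/((m-1)σ_{m+1}²)) · lim_{ε → 0+} ∫_{|y| ≥ ε} (y_j/|y|^{m+1}) |x-y|^{-(m-1)} dy = (1/σ_m) x_j/|x|^m; in particular the principal value limit on the left exists and the integrand is integrable on {|y| ≥ ε} for each ε > 0. (This is the Hilbert transform relation ℋ[a_0] = b_0 of Lemma 3.3(ii).) -/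
open MeasureTheory

open Set Filter Topology Real

theorem integrable_one_add_norm_rpow_mul_norm_rpow {m : ℕ} (hm : 2 ≤ m) :
    Integrable (fun z : EuclideanSpace ℝ (Fin m) =>
      (1 + ‖z‖) ^ (-(m : ℝ)) * ‖z‖ ^ (-((m : ℝ) - 1))) := by
  have hm' : 0 < m := by omega
  have : NeZero m := ⟨hm'.ne'⟩
  have hR : Integrable (fun r : ℝ => (1 + ‖r‖) ^ (-(m : ℝ))) :=
    integrable_one_add_norm (by simpa using (show 1 < m by omega))
  refine (integrable_fun_norm_addHaar (volume : Measure (EuclideanSpace ℝ (Fin m)))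
    (f := fun r : ℝ => (1 + r) ^ (-(m : ℝ)) * r ^ (-((m : ℝ) - 1)))).2 ?_
  refine hR.integrableOn.congr_fun (fun r hr => ?_) measurableSet_Ioi
  have hr : 0 < r := hr
  have h : r ^ (m - 1) * r ^ (-((m : ℝ) - 1)) = 1 := by
    rw [← rpow_natCast, ← rpow_add hr, Nat.cast_sub (by omega)]
    simp
  simp only [finrank_euclideanSpace_fin, smul_eq_mul, norm_of_nonneg hr.le]
  rw [mul_left_comm, h, mul_one]

theorem norm_coord_div_norm_pow_le {m : ℕ} (y : EuclideanSpace ℝ (Fin m)) (j : Fin m) :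
    ‖y j / ‖y‖ ^ (m + 1)‖ ≤ (‖y‖ ^ m)⁻¹ := by
  rcases eq_or_ne y 0 with rfl | hy
  · simp
  have hy' : 0 < ‖y‖ := norm_pos_iff.2 hy
  rw [norm_div, norm_pow, norm_norm, div_le_iff₀ (by positivity), pow_succ,
    inv_mul_cancel_left₀ (by positivity)]
  exact PiLp.norm_apply_le y j

theorem integrableOn_hilbertKernel_mul_norm_rpow {m : ℕ} (hm : 2 ≤ m)
    (x : EuclideanSpace ℝ (Fin m)) (j : Fin m) {ε : ℝ} (hε : 0 < ε) :
    IntegrableOn (fun y : EuclideanSpace ℝ (Fin m) =>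
        y j / ‖y‖ ^ (m + 1) * ‖x - y‖ ^ (-((m : ℝ) - 1)))
      {y : EuclideanSpace ℝ (Fin m) | ε ≤ ‖y‖} := by
  have hG := (integrable_one_add_norm_rpow_mul_norm_rpow hm).comp_sub_left x
  set C : ℝ := (1 + ‖x‖) / ε + 1
  refine (hG.const_mul (C ^ m)).integrableOn.mono'
    (by apply Measurable.aestronglyMeasurable; fun_prop) ?_
  refine ae_restrict_of_forall_mem (measurableSet_le measurable_const measurable_norm)
    fun y hy => ?_
  have hy : ε ≤ ‖y‖ := hy
  have hy0 : 0 < ‖y‖ := hε.trans_le hy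
  have h1 : 1 + ‖x - y‖ ≤ C * ‖y‖ := by
    have h2 : 1 + ‖x‖ ≤ (1 + ‖x‖) / ε * ‖y‖ := by
      rw [div_mul_eq_mul_div, le_div_iff₀ hε]
      gcongr
    have h3 := norm_sub_le x y
    simp only [C, add_mul, one_mul]
    linarith
  have hC : 0 < C := by positivity
  rw [norm_mul, norm_of_nonneg (rpow_nonneg (norm_nonneg (x - y)) _), ← mul_assoc]
  gcongr
  refine (norm_coord_div_norm_pow_le y j).trans ?_
  rw [rpow_neg (by positivity), rpow_natCast, ← div_eq_mul_inv, inv_eq_one_div,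
    div_le_div_iff₀ (by positivity) (by positivity), one_mul, ← mul_pow]
  gcongr

theorem integrable_hilbertKernel_mul_sub {m : ℕ} (hm : 2 ≤ m)
    {x : EuclideanSpace ℝ (Fin m)} (hx : x ≠ 0) (j : Fin m) :
    Integrable (fun y : EuclideanSpace ℝ (Fin m) => y j / ‖y‖ ^ (m + 1) *
      (‖x - y‖ ^ (-((m : ℝ) - 1)) - ‖x + y‖ ^ (-((m : ℝ) - 1)))) := by
  have hC : ContDiffAt ℝ 1 (fun z : EuclideanSpace ℝ (Fin m) => ‖z‖ ^ (-((m : ℝ) - 1))) x :=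
    (contDiffAt_norm ℝ hx).rpow_const_of_ne (norm_ne_zero_iff.2 hx)
  obtain ⟨K, s, hs, hK⟩ := hC.exists_lipschitzOnWith
  obtain ⟨δ, hδ, hball⟩ := Metric.mem_nhds_iff.1 hs
  rw [← integrableOn_univ, ← union_compl_self {y : EuclideanSpace ℝ (Fin m) | δ ≤ ‖y‖}]
  refine IntegrableOn.union ?_ ?_
  · have h1 := integrableOn_hilbertKernel_mul_norm_rpow hm x j hδ
    have h2 := integrableOn_hilbertKernel_mul_norm_rpow hm (-x) j hδ
    refine (h1.sub h2).congr_fun (fun y _ => ?_)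
      (measurableSet_le measurable_const measurable_norm)
    simp only [Pi.sub_apply, mul_sub]
    rw [show -x - y = -(x + y) by abel, norm_neg]
  · have hG := integrable_one_add_norm_rpow_mul_norm_rpow hm
    refine (hG.const_mul (2 * K * (1 + δ) ^ m)).integrableOn.mono'
      (by apply Measurable.aestronglyMeasurable; fun_prop) ?_
    refine ae_restrict_of_forall_mem
      (measurableSet_le measurable_const measurable_norm).compl fun y hy => ?_
    have hy : ‖y‖ < δ := not_le.1 hy
    rcases eq_or_ne y 0 with rfl | hy0
    · simp
      positivity
    have hy0 : 0 < ‖y‖ := norm_pos_iff.2 hy0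
    have hL := hK.norm_sub_le (x := x - y) (y := x + y)
      (hball (by simpa using hy)) (hball (by simpa using hy))
    have h2 : ‖x - y - (x + y)‖ ≤ 2 * ‖y‖ := by
      rw [show x - y - (x + y) = -(y + y) by abel, norm_neg, two_mul]
      exact norm_add_le y y
    have h3 : ‖y‖ ^ (-((m : ℝ) - 1)) = (‖y‖ ^ m)⁻¹ * ‖y‖ := by
      rw [neg_sub, sub_eq_neg_add, rpow_add hy0, rpow_neg hy0.le, rpow_natCast, rpow_one]
    have h4 : 1 ≤ (1 + δ) ^ m * (1 + ‖y‖) ^ (-(m : ℝ)) := by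
      rw [rpow_neg (by positivity), rpow_natCast, ← div_eq_mul_inv, one_le_div (by positivity)]
      gcongr
    rw [norm_mul]
    calc _ ≤ (‖y‖ ^ m)⁻¹ * (K * (2 * ‖y‖)) := by
          gcongr
          · exact norm_coord_div_norm_pow_le y j
          · exact hL.trans (by gcongr)
      _ = 1 * (2 * K * ((‖y‖ ^ m)⁻¹ * ‖y‖)) := by ring
      _ ≤ ((1 + δ) ^ m * (1 + ‖y‖) ^ (-(m : ℝ))) * (2 * K * ((‖y‖ ^ m)⁻¹ * ‖y‖)) := by gcongr
      _ = _ := by rw [h3]; ring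

theorem tendsto_setIntegral_hilbertKernel {m : ℕ} (hm : 2 ≤ m)
    {x : EuclideanSpace ℝ (Fin m)} (hx : x ≠ 0) (j : Fin m) :
    Tendsto (fun ε : ℝ => ∫ y in {y : EuclideanSpace ℝ (Fin m) | ε ≤ ‖y‖},
        y j / ‖y‖ ^ (m + 1) * ‖x - y‖ ^ (-((m : ℝ) - 1))) (𝓝[>] 0)
      (𝓝 ((∫ y : EuclideanSpace ℝ (Fin m), y j / ‖y‖ ^ (m + 1) *
        (‖x - y‖ ^ (-((m : ℝ) - 1)) - ‖x + y‖ ^ (-((m : ℝ) - 1)))) / 2)) := by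
  have hm0 : 0 < m := by omega
  have : NeZero m := ⟨hm0.ne'⟩
  have hcov : AECover (volume : Measure (EuclideanSpace ℝ (Fin m))) (𝓝[>] (0 : ℝ))
      (fun ε : ℝ => {y : EuclideanSpace ℝ (Fin m) | ε ≤ ‖y‖}) := by
    refine ⟨?_, fun ε => measurableSet_le measurable_const measurable_norm⟩
    filter_upwards [compl_mem_ae_iff.2 (measure_singleton (0 : EuclideanSpace ℝ (Fin m)))]
      with y hy
    have hy : 0 < ‖y‖ := norm_pos_iff.2 hy
    exact mem_nhdsWithin_of_mem_nhds (Iic_mem_nhds hy)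
  refine ((hcov.integral_tendsto_of_countably_generated
    (integrable_hilbertKernel_mul_sub hm hx j)).div_const 2).congr' ?_
  filter_upwards [self_mem_nhdsWithin] with ε hε
  have hS : MeasurableSet {y : EuclideanSpace ℝ (Fin m) | ε ≤ ‖y‖} :=
    measurableSet_le measurable_const measurable_norm
  have h1 := integrableOn_hilbertKernel_mul_norm_rpow hm x j hε
  have hneg : ∫ y in {y : EuclideanSpace ℝ (Fin m) | ε ≤ ‖y‖},
      y j / ‖y‖ ^ (m + 1) * ‖x - y‖ ^ (-((m : ℝ) - 1)) =
      - ∫ y in {y : EuclideanSpace ℝ (Fin m) | ε ≤ ‖y‖},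
      y j / ‖y‖ ^ (m + 1) * ‖x + y‖ ^ (-((m : ℝ) - 1)) := by
    rw [← integral_indicator hS, ← integral_indicator hS, ← integral_neg_eq_self, ← integral_neg]
    congr 1 with y
    by_cases h : ε ≤ ‖y‖ <;> simp [indicator, h, neg_div]
  have h2 : IntegrableOn (fun y : EuclideanSpace ℝ (Fin m) =>
        y j / ‖y‖ ^ (m + 1) * ‖x + y‖ ^ (-((m : ℝ) - 1)))
      {y : EuclideanSpace ℝ (Fin m) | ε ≤ ‖y‖} := by
    refine (integrableOn_hilbertKernel_mul_norm_rpow hm (-x) j hε).congr_fun (fun y _ => ?_) hS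
    simp only
    rw [show -x - y = -(x + y) by abel, norm_neg]
  simp_rw [mul_sub]
  rw [integral_sub h1 h2, hneg]
  ring

theorem integrable_coord_mul_gaussian {m : ℕ} (j : Fin m) {b : ℝ} (hb : 0 < b) :
    Integrable (fun y : EuclideanSpace ℝ (Fin m) => y j * exp (-b * ‖y‖ ^ 2)) := by
  have hm : 0 < m := j.pos
  have : NeZero m := ⟨hm.ne'⟩
  have h : Integrable (fun y : EuclideanSpace ℝ (Fin m) => ‖y‖ * exp (-b * ‖y‖ ^ 2)) := by
    refine (integrable_fun_norm_addHaar (volume : Measure (EuclideanSpace ℝ (Fin m)))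
      (f := fun r : ℝ => r * exp (-b * r ^ 2))).2 ?_
    refine (integrableOn_rpow_mul_exp_neg_mul_sq hb (s := (m : ℝ))
      (neg_one_lt_zero.trans_le m.cast_nonneg)).congr_fun (fun r _ => ?_) measurableSet_Ioi
    simp only [finrank_euclideanSpace_fin, smul_eq_mul, rpow_natCast]
    rw [← mul_assoc, pow_sub_one_mul hm.ne']
  refine h.mono' (by fun_prop) (ae_of_all _ fun y => ?_)
  rw [norm_mul, norm_of_nonneg (exp_pos _).le]
  gcongr
  exact PiLp.norm_apply_le y j

theorem integral_coord_mul_gaussian {m : ℕ} (j : Fin m) (b : ℝ) :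
    ∫ y : EuclideanSpace ℝ (Fin m), y j * exp (-b * ‖y‖ ^ 2) = 0 := by
  have h := integral_neg_eq_self (fun y : EuclideanSpace ℝ (Fin m) => y j * exp (-b * ‖y‖ ^ 2))
    volume
  simp only [norm_neg, PiLp.neg_apply, neg_mul, integral_neg] at h ⊢
  linarith

theorem exp_mul_exp_eq_exp_translate {E : Type*} [NormedAddCommGroup E] [InnerProductSpace ℝ E]
    (x y : E) {s t : ℝ} (hst : s + t ≠ 0) :
    exp (-(‖y‖ ^ 2 * t)) * exp (-(‖x - y‖ ^ 2 * s)) =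
      exp (-(s * t / (s + t) * ‖x‖ ^ 2)) * exp (-(s + t) * ‖y - (s / (s + t)) • x‖ ^ 2) := by
  rw [← exp_add, ← exp_add, norm_sub_sq_real, norm_sub_sq_real, inner_smul_right, norm_smul,
    real_inner_comm y x, mul_pow, norm_eq_abs, sq_abs]
  congr 1
  field_simp
  ring

theorem coord_mul_exp_mul_exp_eq {m : ℕ} (x y : EuclideanSpace ℝ (Fin m)) (j : Fin m) {s t : ℝ}
    (hst : s + t ≠ 0) :
    y j * (exp (-(‖y‖ ^ 2 * t)) * exp (-(‖x - y‖ ^ 2 * s))) =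
      exp (-(s * t / (s + t) * ‖x‖ ^ 2)) *
        ((y - (s / (s + t)) • x) j * exp (-(s + t) * ‖y - (s / (s + t)) • x‖ ^ 2) +
          s / (s + t) * x j * exp (-(s + t) * ‖y - (s / (s + t)) • x‖ ^ 2)) := by
  rw [exp_mul_exp_eq_exp_translate x y hst]
  simp only [PiLp.sub_apply, PiLp.smul_apply, smul_eq_mul]
  ring

theorem integrable_gaussian_norm {m : ℕ} {b : ℝ} (hb : 0 < b) :
    Integrable (fun y : EuclideanSpace ℝ (Fin m) => exp (-b * ‖y‖ ^ 2)) := by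
  refine not_imp_comm.1 integral_undef ?_
  rw [GaussianFourier.integral_rexp_neg_mul_sq_norm hb]
  positivity

theorem integrable_coord_mul_exp_mul_exp {m : ℕ} (x : EuclideanSpace ℝ (Fin m)) (j : Fin m)
    {s t : ℝ} (hs : 0 < s) (ht : 0 < t) :
    Integrable (fun y : EuclideanSpace ℝ (Fin m) =>
      y j * (exp (-(‖y‖ ^ 2 * t)) * exp (-(‖x - y‖ ^ 2 * s)))) := by
  have hst : 0 < s + t := add_pos hs ht
  simp_rw [coord_mul_exp_mul_exp_eq x _ j hst.ne']
  exact (((integrable_coord_mul_gaussian j hst).comp_sub_right _).add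
    (((integrable_gaussian_norm hst).comp_sub_right _).const_mul _)).const_mul _

theorem integral_coord_mul_exp_mul_exp {m : ℕ} (x : EuclideanSpace ℝ (Fin m)) (j : Fin m)
    {s t : ℝ} (hs : 0 < s) (ht : 0 < t) :
    ∫ y : EuclideanSpace ℝ (Fin m), y j * (exp (-(‖y‖ ^ 2 * t)) * exp (-(‖x - y‖ ^ 2 * s))) =
      exp (-(s * t / (s + t) * ‖x‖ ^ 2)) *
        (s / (s + t) * x j * (π / (s + t)) ^ ((m : ℝ) / 2)) := by
  have hst : 0 < s + t := add_pos hs ht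
  simp_rw [coord_mul_exp_mul_exp_eq x _ j hst.ne']
  rw [integral_const_mul, integral_add ((integrable_coord_mul_gaussian j hst).comp_sub_right _)
    (((integrable_gaussian_norm hst).comp_sub_right _).const_mul _), integral_const_mul,
    integral_sub_right_eq_self (fun y : EuclideanSpace ℝ (Fin m) => exp (-(s + t) * ‖y‖ ^ 2)),
    integral_sub_right_eq_self
      (fun y : EuclideanSpace ℝ (Fin m) => y j * exp (-(s + t) * ‖y‖ ^ 2)),
    integral_coord_mul_gaussian, GaussianFourier.integral_rexp_neg_mul_sq_norm hst, zero_add,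
    finrank_euclideanSpace_fin]

theorem integral_coord_mul_exp_mul_sub {m : ℕ} (x : EuclideanSpace ℝ (Fin m)) (j : Fin m)
    {s t : ℝ} (hs : 0 < s) (ht : 0 < t) :
    ∫ y : EuclideanSpace ℝ (Fin m), y j * (exp (-(‖y‖ ^ 2 * t)) *
      (exp (-(‖x - y‖ ^ 2 * s)) - exp (-(‖x + y‖ ^ 2 * s)))) =
      2 * (exp (-(s * t / (s + t) * ‖x‖ ^ 2)) *
        (s / (s + t) * x j * (π / (s + t)) ^ ((m : ℝ) / 2))) := by
  have hneg : ∀ y : EuclideanSpace ℝ (Fin m), ‖x + y‖ = ‖-x - y‖ := fun y => by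
    rw [show -x - y = -(x + y) by abel, norm_neg]
  simp_rw [mul_sub, hneg]
  rw [integral_sub (integrable_coord_mul_exp_mul_exp x j hs ht)
    (integrable_coord_mul_exp_mul_exp (-x) j hs ht), integral_coord_mul_exp_mul_exp x j hs ht,
    integral_coord_mul_exp_mul_exp (-x) j hs ht, norm_neg, PiLp.neg_apply]
  ring

theorem integrableOn_rpow_mul_exp_neg_mul {a p : ℝ} (ha : 0 < a) (hp : 0 < p) :
    IntegrableOn (fun t : ℝ => t ^ (a - 1) * exp (-(p * t))) (Ioi 0) := by
  refine not_imp_comm.1 integral_undef ?_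
  rw [integral_rpow_mul_exp_neg_mul_Ioi ha hp]
  have := Gamma_pos_of_pos ha
  positivity

theorem integral_norm_rpow_mul_exp_sub_exp (a : ℝ) {p q : ℝ} (hp : 0 < p) (hq : 0 < q) :
    ∫ t in Ioi (0 : ℝ), ‖t ^ (a - 1) * (exp (-(p * t)) - exp (-(q * t)))‖ =
      ‖∫ t in Ioi (0 : ℝ), t ^ (a - 1) * (exp (-(p * t)) - exp (-(q * t)))‖ := by
  wlog hpq : p ≤ q generalizing p q
  · have h := this hq hp (le_of_not_ge hpq)
    have hflip : ∀ t : ℝ, t ^ (a - 1) * (exp (-(p * t)) - exp (-(q * t))) =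
        -(t ^ (a - 1) * (exp (-(q * t)) - exp (-(p * t)))) := fun t => by ring
    simp_rw [hflip, norm_neg, integral_neg, norm_neg, h]
  have hnn : ∀ t ∈ Ioi (0 : ℝ), 0 ≤ t ^ (a - 1) * (exp (-(p * t)) - exp (-(q * t))) := by
    intro t ht
    have ht : 0 < t := ht
    have : exp (-(q * t)) ≤ exp (-(p * t)) := by gcongr
    exact mul_nonneg (rpow_nonneg ht.le _) (sub_nonneg.2 this)
  rw [norm_of_nonneg (setIntegral_nonneg measurableSet_Ioi hnn)]
  exact setIntegral_congr_fun measurableSet_Ioi fun t ht => norm_of_nonneg (hnn t ht)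

theorem integral_rpow_mul_exp_neg_norm_sq_mul {E : Type*} [NormedAddCommGroup E] {a : ℝ}
    (ha : 0 < a) {z : E} (hz : z ≠ 0) :
    ∫ t in Ioi (0 : ℝ), t ^ (a - 1) * exp (-(‖z‖ ^ 2 * t)) = ‖z‖ ^ (-(2 * a)) * Gamma a := by
  have hz' : 0 < ‖z‖ := norm_pos_iff.2 hz
  rw [integral_rpow_mul_exp_neg_mul_Ioi ha (by positivity), one_div, inv_rpow (by positivity),
    ← rpow_natCast, ← rpow_mul hz'.le, ← rpow_neg hz'.le]
  simp

theorem integrableOn_and_integral_inv_sqrt_mul_one_add :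
    IntegrableOn (fun u : ℝ => (√u * (1 + u))⁻¹) (Ioi 0) ∧
      ∫ u in Ioi (0 : ℝ), (√u * (1 + u))⁻¹ = π := by
  have hc : ContinuousWithinAt (fun u : ℝ => 2 * arctan √u) (Ici 0) 0 := by
    apply Continuous.continuousWithinAt
    fun_prop
  have hd : ∀ u ∈ Ioi (0 : ℝ), HasDerivAt (fun u : ℝ => 2 * arctan √u) (√u * (1 + u))⁻¹ u := by
    intro u hu
    have hu : 0 < u := hu
    have h := ((hasDerivAt_sqrt hu.ne').arctan).const_mul 2
    rw [sq_sqrt hu.le] at h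
    have := sqrt_pos.2 hu
    refine h.congr_deriv ?_
    have : 0 < 1 + u := by linarith
    field_simp
  have hn : ∀ u ∈ Ioi (0 : ℝ), 0 ≤ (√u * (1 + u))⁻¹ := by
    intro u hu
    have hu : 0 < u := hu
    positivity
  have ht : Tendsto (fun u : ℝ => 2 * arctan √u) atTop (𝓝 π) := by
    have := ((tendsto_arctan_atTop.mono_right nhdsWithin_le_nhds).comp
      tendsto_sqrt_atTop).const_mul 2
    rwa [mul_div_cancel₀ _ two_ne_zero] at this
  refine ⟨integrableOn_Ioi_deriv_of_nonneg hc hd hn ht, ?_⟩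
  rw [integral_Ioi_of_hasDerivAt_of_nonneg hc hd hn ht]
  simp

theorem integral_integral_heat_kernel (k : ℕ) (hk : 0 < k) {r : ℝ} (hr : 0 < r) :
    ∫ t in Ioi (0 : ℝ), ∫ s in Ioi (0 : ℝ),
      t ^ (((k : ℝ) + 1) / 2 - 1) * s ^ (((k : ℝ) - 1) / 2) *
        ((s + t) ^ (-((k : ℝ) / 2 + 1)) * exp (-(s * t / (s + t) * r ^ 2))) =
      π * Gamma ((k : ℝ) / 2) * r ^ (-(k : ℝ)) := by
  have hk' : (0 : ℝ) < (k : ℝ) / 2 := by positivity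
  set Φ : ℝ → ℝ → ℝ := fun u t => u ^ (((k : ℝ) - 1) / 2) * (1 + u) ^ (-((k : ℝ) / 2 + 1)) *
    (t ^ ((k : ℝ) / 2 - 1) * exp (-(u / (1 + u) * r ^ 2 * t))) with hΦ
  have hscale : ∀ t ∈ Ioi (0 : ℝ), ∫ s in Ioi (0 : ℝ),
      t ^ (((k : ℝ) + 1) / 2 - 1) * s ^ (((k : ℝ) - 1) / 2) *
        ((s + t) ^ (-((k : ℝ) / 2 + 1)) * exp (-(s * t / (s + t) * r ^ 2))) =
      ∫ u in Ioi (0 : ℝ), Φ u t := by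
    intro t ht
    have ht : 0 < t := ht
    rw [← mul_zero t, ← integral_comp_mul_left_Ioi' _ _ ht, smul_eq_mul, ← integral_const_mul,
      mul_zero]
    refine setIntegral_congr_fun measurableSet_Ioi fun u hu => ?_
    have hu : 0 < u := hu
    have hu1 : 0 < 1 + u := by positivity
    have he : t * u * t / (t * u + t) * r ^ 2 = u / (1 + u) * r ^ 2 * t := by
      field_simp
      ring
    have hp : t * (t ^ (((k : ℝ) + 1) / 2 - 1) * t ^ (((k : ℝ) - 1) / 2) *
        t ^ (-((k : ℝ) / 2 + 1))) = t ^ ((k : ℝ) / 2 - 1) := by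
      rw [← rpow_add ht, ← rpow_add ht, mul_comm, ← rpow_add_one ht.ne']
      congr 1
      ring
    simp only [hΦ]
    rw [he, show t * u + t = t * (1 + u) by ring, mul_rpow ht.le hu.le, mul_rpow ht.le hu1.le,
      ← hp]
    ring
  have hint : ∀ u ∈ Ioi (0 : ℝ), ∫ t in Ioi (0 : ℝ), Φ u t =
      Gamma ((k : ℝ) / 2) * r ^ (-(k : ℝ)) * (√u * (1 + u))⁻¹ := by
    intro u hu
    have hu : 0 < u := hu
    have hu1 : 0 < 1 + u := by positivity
    simp only [hΦ]
    rw [integral_const_mul, integral_rpow_mul_exp_neg_mul_Ioi hk' (by positivity), one_div,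
      inv_rpow (by positivity), mul_rpow (by positivity) (by positivity),
      div_rpow hu.le hu1.le, ← rpow_natCast r 2, ← rpow_mul hr.le, rpow_neg hr.le,
      rpow_neg hu1.le, rpow_add hu1, rpow_one, sub_div, rpow_sub hu, ← sqrt_eq_rpow]
    have h1 : (0 : ℝ) < (1 + u) ^ ((k : ℝ) / 2) := by positivity
    have h2 : (0 : ℝ) < u ^ ((k : ℝ) / 2) := by positivity
    have h3 : ((2 : ℕ) : ℝ) * ((k : ℝ) / 2) = k := by
      push_cast
      ring
    have h4 : (0 : ℝ) < r ^ (k : ℝ) := by positivity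
    have h5 := sqrt_pos.2 hu
    rw [h3]
    field_simp
  have hnn : ∀ u ∈ Ioi (0 : ℝ), ∀ t ∈ Ioi (0 : ℝ), 0 ≤ Φ u t := by
    intro u hu t ht
    have hu : 0 < u := hu
    have ht : 0 < t := ht
    simp only [hΦ]
    positivity
  obtain ⟨hI, hIπ⟩ := integrableOn_and_integral_inv_sqrt_mul_one_add
  have hprod : Integrable (Function.uncurry Φ)
      ((volume.restrict (Ioi 0)).prod (volume.restrict (Ioi 0))) := by
    refine (integrable_prod_iff ?_).2 ⟨?_, ?_⟩
    · apply Measurable.aestronglyMeasurable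
      simp only [hΦ, Function.uncurry_def]
      fun_prop
    · refine ae_restrict_of_forall_mem measurableSet_Ioi fun u hu => ?_
      have hu : 0 < u := hu
      have hp : 0 < u / (1 + u) * r ^ 2 := by positivity
      exact (integrableOn_rpow_mul_exp_neg_mul hk' hp).const_mul
        (u ^ (((k : ℝ) - 1) / 2) * (1 + u) ^ (-((k : ℝ) / 2 + 1)))
    · refine (hI.const_mul (Gamma ((k : ℝ) / 2) * r ^ (-(k : ℝ)))).congr ?_
      refine ae_restrict_of_forall_mem measurableSet_Ioi fun u hu => ?_
      simp only [← hint u hu]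
      exact setIntegral_congr_fun measurableSet_Ioi fun t ht =>
        (norm_of_nonneg (hnn u hu t ht)).symm
  rw [setIntegral_congr_fun measurableSet_Ioi hscale, ← integral_integral_swap hprod,
    setIntegral_congr_fun measurableSet_Ioi hint, integral_const_mul, hIπ]
  ring

theorem integral_hilbertKernel_mul_sub {m : ℕ} (hm : 2 ≤ m)
    {x : EuclideanSpace ℝ (Fin m)} (hx : x ≠ 0) (j : Fin m) :
    Gamma (((m : ℝ) + 1) / 2) * Gamma (((m : ℝ) - 1) / 2) *
      ∫ y : EuclideanSpace ℝ (Fin m), y j / ‖y‖ ^ (m + 1) *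
        (‖x - y‖ ^ (-((m : ℝ) - 1)) - ‖x + y‖ ^ (-((m : ℝ) - 1))) =
      2 * (π ^ ((m : ℝ) / 2) * (π * Gamma ((m : ℝ) / 2) * ‖x‖ ^ (-(m : ℝ))) * x j) := by
  have hm0 : 0 < m := by omega
  have : NeZero m := ⟨hm0.ne'⟩
  have hm2 : (2 : ℝ) ≤ m := by exact_mod_cast hm
  have ha : (0 : ℝ) < ((m : ℝ) + 1) / 2 := by positivity
  have hb : (0 : ℝ) < ((m : ℝ) - 1) / 2 := by linarith
  set μ : Measure (ℝ × ℝ) := (volume.restrict (Ioi 0)).prod (volume.restrict (Ioi 0)) with hμ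
  set P : EuclideanSpace ℝ (Fin m) → ℝ → ℝ := fun y t =>
    t ^ (((m : ℝ) + 1) / 2 - 1) * exp (-(‖y‖ ^ 2 * t)) with hP
  set Q : EuclideanSpace ℝ (Fin m) → ℝ → ℝ := fun y s =>
    s ^ (((m : ℝ) - 1) / 2 - 1) * (exp (-(‖x - y‖ ^ 2 * s)) - exp (-(‖x + y‖ ^ 2 * s))) with hQ
  set F : EuclideanSpace ℝ (Fin m) → ℝ × ℝ → ℝ := fun y z => y j * (P y z.1 * Q y z.2) with hF
  have hne : ∀ᵐ y : EuclideanSpace ℝ (Fin m), y ≠ 0 ∧ x - y ≠ 0 ∧ x + y ≠ 0 := by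
    filter_upwards [compl_mem_ae_iff.2 (measure_singleton (0 : EuclideanSpace ℝ (Fin m))),
      compl_mem_ae_iff.2 (measure_singleton x), compl_mem_ae_iff.2 (measure_singleton (-x))]
      with y h0 h1 h2
    exact ⟨h0, sub_ne_zero.2 (Ne.symm h1), fun h => h2 (neg_eq_of_add_eq_zero_right h).symm⟩
  have hPi : ∀ y : EuclideanSpace ℝ (Fin m), y ≠ 0 → IntegrableOn (P y) (Ioi 0) := fun y hy =>
    integrableOn_rpow_mul_exp_neg_mul ha (pow_pos (norm_pos_iff.2 hy) 2)
  have hQi : ∀ y : EuclideanSpace ℝ (Fin m), x - y ≠ 0 → x + y ≠ 0 →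
      IntegrableOn (Q y) (Ioi 0) ∧ ∫ s in Ioi (0 : ℝ), Q y s = Gamma (((m : ℝ) - 1) / 2) *
        (‖x - y‖ ^ (-((m : ℝ) - 1)) - ‖x + y‖ ^ (-((m : ℝ) - 1))) := by
    intro y h1 h2
    have i1 := integrableOn_rpow_mul_exp_neg_mul hb (pow_pos (norm_pos_iff.2 h1) 2)
    have i2 := integrableOn_rpow_mul_exp_neg_mul hb (pow_pos (norm_pos_iff.2 h2) 2)
    simp only [hQ, mul_sub]
    refine ⟨i1.sub i2, ?_⟩
    rw [integral_sub i1 i2, integral_rpow_mul_exp_neg_norm_sq_mul hb h1,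
      integral_rpow_mul_exp_neg_norm_sq_mul hb h2, mul_div_cancel₀ _ two_ne_zero]
    ring
  have hPv : ∀ y : EuclideanSpace ℝ (Fin m), y ≠ 0 →
      ∫ t in Ioi (0 : ℝ), P y t = Gamma (((m : ℝ) + 1) / 2) * (‖y‖ ^ (m + 1))⁻¹ := by
    intro y hy
    rw [integral_rpow_mul_exp_neg_norm_sq_mul ha hy, mul_div_cancel₀ _ two_ne_zero,
      rpow_neg (norm_nonneg y), mul_comm, ← rpow_natCast, Nat.cast_add_one]
  have hFv : ∀ y : EuclideanSpace ℝ (Fin m), y ≠ 0 ∧ x - y ≠ 0 ∧ x + y ≠ 0 →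
      ∫ z, F y z ∂μ = Gamma (((m : ℝ) + 1) / 2) * Gamma (((m : ℝ) - 1) / 2) *
        (y j / ‖y‖ ^ (m + 1) *
          (‖x - y‖ ^ (-((m : ℝ) - 1)) - ‖x + y‖ ^ (-((m : ℝ) - 1)))) := by
    rintro y ⟨h0, h1, h2⟩
    rw [integral_const_mul, integral_prod_mul, hPv y h0, (hQi y h1 h2).2]
    ring
  have hFn : ∀ y : EuclideanSpace ℝ (Fin m), y ≠ 0 ∧ x - y ≠ 0 ∧ x + y ≠ 0 →
      ∫ z, ‖F y z‖ ∂μ = ‖∫ z, F y z ∂μ‖ := by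
    rintro y ⟨h0, h1, h2⟩
    have hPn : ∫ t in Ioi (0 : ℝ), ‖P y t‖ = ‖∫ t in Ioi (0 : ℝ), P y t‖ := by
      have hP0 : ∀ t ∈ Ioi (0 : ℝ), 0 ≤ P y t := fun t ht =>
        mul_nonneg (rpow_nonneg (le_of_lt ht) _) (exp_pos _).le
      rw [norm_of_nonneg (setIntegral_nonneg measurableSet_Ioi hP0)]
      exact setIntegral_congr_fun measurableSet_Ioi fun t ht => norm_of_nonneg (hP0 t ht)
    have hQn := integral_norm_rpow_mul_exp_sub_exp (((m : ℝ) - 1) / 2) (pow_pos (norm_pos_iff.2 h1) 2)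
      (pow_pos (norm_pos_iff.2 h2) 2)
    simp only [hF, norm_mul (y j), norm_mul (P y _)]
    rw [integral_const_mul, integral_const_mul, integral_prod_mul (P y) (Q y),
      integral_prod_mul (fun t => ‖P y t‖) (fun s => ‖Q y s‖), hPn, hQn, norm_mul, norm_mul]
  have hFi : Integrable (Function.uncurry F) (volume.prod μ) := by
    refine (integrable_prod_iff ?_).2 ⟨?_, ?_⟩
    · apply Measurable.aestronglyMeasurable
      simp only [hF, hP, hQ, Function.uncurry_def]
      fun_prop
    · filter_upwards [hne] with y hy
      exact ((hPi y hy.1).mul_prod (hQi y hy.2.1 hy.2.2).1).const_mul (y j)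
    · refine ((integrable_hilbertKernel_mul_sub hm hx j).const_mul
        (Gamma (((m : ℝ) + 1) / 2) * Gamma (((m : ℝ) - 1) / 2))).norm.congr ?_
      filter_upwards [hne] with y hy
      rw [← hFv y hy, ← hFn y hy]
      rfl
  set J : ℝ → ℝ → ℝ := fun t s => t ^ (((m : ℝ) + 1) / 2 - 1) * s ^ (((m : ℝ) - 1) / 2) *
        ((s + t) ^ (-((m : ℝ) / 2 + 1)) * exp (-(s * t / (s + t) * ‖x‖ ^ 2))) with hJ
  have hFJ : ∀ t ∈ Ioi (0 : ℝ), ∀ s ∈ Ioi (0 : ℝ),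
      ∫ y, F y (t, s) = 2 * π ^ ((m : ℝ) / 2) * x j * J t s := by
    intro t ht s hs
    have ht : 0 < t := ht
    have hs : 0 < s := hs
    have hst : 0 < s + t := by positivity
    have h : ∀ y : EuclideanSpace ℝ (Fin m), F y (t, s) =
        t ^ (((m : ℝ) + 1) / 2 - 1) * s ^ (((m : ℝ) - 1) / 2 - 1) * (y j * (exp (-(‖y‖ ^ 2 * t)) *
          (exp (-(‖x - y‖ ^ 2 * s)) - exp (-(‖x + y‖ ^ 2 * s))))) := fun y => by
      simp only [hF, hP, hQ]
      ring
    simp_rw [h]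
    rw [integral_const_mul, integral_coord_mul_exp_mul_sub x j hs ht]
    simp only [hJ]
    rw [div_rpow pi_pos.le hst.le, rpow_neg hst.le, rpow_add hst, rpow_one, rpow_sub_one hs.ne']
    have : (0 : ℝ) < (s + t) ^ ((m : ℝ) / 2) := by positivity
    field_simp
  calc _ = ∫ y, ∫ z, F y z ∂μ := by
        rw [← integral_const_mul]
        refine integral_congr_ae ?_
        filter_upwards [hne] with y hy
        exact (hFv y hy).symm
    _ = ∫ z, (∫ y, F y z) ∂μ := integral_integral_swap hFi
    _ = ∫ t in Ioi (0 : ℝ), ∫ s in Ioi (0 : ℝ), ∫ y, F y (t, s) :=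
        integral_prod _ hFi.integral_prod_right
    _ = ∫ t in Ioi (0 : ℝ), 2 * π ^ ((m : ℝ) / 2) * x j * ∫ s in Ioi (0 : ℝ), J t s := by
        refine setIntegral_congr_fun measurableSet_Ioi fun t ht => ?_
        simp only [← integral_const_mul]
        exact setIntegral_congr_fun measurableSet_Ioi (hFJ t ht)
    _ = _ := by
        rw [integral_const_mul, integral_integral_heat_kernel m hm0 (norm_pos_iff.2 hx)]
        ring

theorem hilbert_transform_of_a0_is_b0
    (m : ℕ) (hm : 2 ≤ m) (x : EuclideanSpace ℝ (Fin m)) (hx : x ≠ 0) (j : Fin m) :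
    ∃ L : ℝ,
      (∀ ε : ℝ, 0 < ε →
        IntegrableOn (fun y : EuclideanSpace ℝ (Fin m) =>
            y j / ‖y‖ ^ (m + 1) * ‖x - y‖ ^ (-((m : ℝ) - 1)))
          {y : EuclideanSpace ℝ (Fin m) | ε ≤ ‖y‖}) ∧
      Filter.Tendsto (fun ε : ℝ =>
          ∫ y in {y : EuclideanSpace ℝ (Fin m) | ε ≤ ‖y‖},
            y j / ‖y‖ ^ (m + 1) * ‖x - y‖ ^ (-((m : ℝ) - 1)))
        (nhdsWithin 0 (Set.Ioi 0)) (nhds L) ∧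
      4 / (((m : ℝ) - 1) * sphereArea (m + 1) ^ 2) * L = 1 / sphereArea m * x j / ‖x‖ ^ m := by
  refine ⟨_, fun ε hε => integrableOn_hilbertKernel_mul_norm_rpow hm x j hε,
    tendsto_setIntegral_hilbertKernel hm hx j, ?_⟩
  have key := integral_hilbertKernel_mul_sub hm hx j
  set I := ∫ y : EuclideanSpace ℝ (Fin m), y j / ‖y‖ ^ (m + 1) *
    (‖x - y‖ ^ (-((m : ℝ) - 1)) - ‖x + y‖ ^ (-((m : ℝ) - 1)))
  have hm2 : (2 : ℝ) ≤ m := by exact_mod_cast hm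
  have hm1 : (0 : ℝ) < (m : ℝ) - 1 := by linarith
  have hx' : 0 < ‖x‖ := norm_pos_iff.2 hx
  have hΓ : Gamma (((m : ℝ) + 1) / 2) = ((m : ℝ) - 1) / 2 * Gamma (((m : ℝ) - 1) / 2) := by
    rw [← Gamma_add_one (by positivity)]
    congr 1
    ring
  have hΓ0 : 0 < Gamma (((m : ℝ) - 1) / 2) := Gamma_pos_of_pos (by positivity)
  have hΓ1 : 0 < Gamma ((m : ℝ) / 2) := Gamma_pos_of_pos (by positivity)
  have hpi : (π ^ (((m : ℝ) + 1) / 2)) ^ 2 = π ^ ((m : ℝ) / 2) * π ^ ((m : ℝ) / 2) * π := by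
    rw [← rpow_natCast, ← rpow_mul pi_pos.le, ← rpow_add pi_pos, ← rpow_add_one pi_pos.ne']
    congr 1
    push_cast
    ring
  have hpi0 : (0 : ℝ) < π ^ ((m : ℝ) / 2) := by positivity
  rw [hΓ, rpow_neg hx'.le, rpow_natCast] at key
  simp only [sphereArea, Nat.cast_add, Nat.cast_one]
  rw [div_pow, mul_pow, hpi, hΓ]
  field_simp at key ⊢
  linear_combination 4 * key
end

section
/- Let m ≥ 1 be an integer and let P(t,x) = (2/σ_{m+1}) t (t²+|x|²)^{-(m+1)/2}. For every Schwartz function φ on ℝ^m: (a) the limit L(φ) = lim_{ε → 0+} ( ∫_{|x| ≥ ε} φ(x)/|x|^{m+1} dx − (σ_m/ε) φ(0) ) exists (the finite part Fp∫ φ(x)/|x|^{m+1} dx), and (b) lim_{t → 0+} ∫_{ℝ^m} (∂_t P)(t,x) φ(x) dx = (2/σ_{m+1}) · L(φ). (This is the distributional boundary value a_{-2} = (2/σ_{m+1}) Fp |x|^{-(m+1)} of the downstream harmonic potential A_{-2} = ∂_{x_0} A_{-1}.) -/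
open MeasureTheory

/-- The Poisson kernel `P(t,x) = (2/σ_{m+1}) t (t²+|x|²)^{-(m+1)/2}`. -/
noncomputable def poissonP (m : ℕ) (t : ℝ) (x : EuclideanSpace ℝ (Fin m)) : ℝ :=
  2 / sphereArea (m + 1) * t * (t ^ 2 + ‖x‖ ^ 2) ^ (-(((m : ℝ) + 1) / 2))

open Set Filter Topology

/-- The polar-coordinates constant is the area of the unit sphere. -/
lemma natCast_mul_volume_real_ball_eq_sphereArea {m : ℕ} (hm : 1 ≤ m) :
    (m : ℝ) * volume.real (Metric.ball (0 : EuclideanSpace ℝ (Fin m)) 1) = sphereArea m := by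
  have : Nonempty (Fin m) := ⟨⟨0, hm⟩⟩
  have hm0 : (0 : ℝ) < m := by exact_mod_cast hm
  have hG : 0 < Real.Gamma ((m : ℝ) / 2) := Real.Gamma_pos_of_pos (by positivity)
  have hpi : √Real.pi ^ m = Real.pi ^ ((m : ℝ) / 2) := by
    rw [Real.sqrt_eq_rpow, ← Real.rpow_natCast, ← Real.rpow_mul Real.pi_pos.le]
    congr 1
    ring
  rw [Measure.real, EuclideanSpace.volume_ball, Fintype.card_fin, sphereArea,
    Real.Gamma_add_one (by positivity), hpi, ENNReal.ofReal_one, one_pow, one_mul,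
    ENNReal.toReal_ofReal (by positivity)]
  field_simp

/-- Integration of a radial function in polar coordinates. -/
lemma integral_radial_eq_sphereArea_mul {m : ℕ} (hm : 1 ≤ m) (f : ℝ → ℝ) :
    ∫ x : EuclideanSpace ℝ (Fin m), f ‖x‖ =
      sphereArea m * ∫ r in Ioi (0 : ℝ), r ^ (m - 1) * f r := by
  have : Nonempty (Fin m) := ⟨⟨0, hm⟩⟩
  rw [integral_fun_norm_addHaar, ← natCast_mul_volume_real_ball_eq_sphereArea hm]
  simp [nsmul_eq_mul, mul_assoc]

lemma integrable_radial_iff {m : ℕ} (hm : 1 ≤ m) {f : ℝ → ℝ} :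
    Integrable (fun x : EuclideanSpace ℝ (Fin m) => f ‖x‖) ↔
      IntegrableOn (fun r => r ^ (m - 1) * f r) (Ioi (0 : ℝ)) := by
  have : Nonempty (Fin m) := ⟨⟨0, hm⟩⟩
  rw [integrable_fun_norm_addHaar]
  simp

lemma pow_pred_mul_inv_pow_succ {m : ℕ} (hm : 1 ≤ m) {r : ℝ} (hr : 0 < r) :
    r ^ (m - 1) * (r ^ (m + 1))⁻¹ = r ^ (-2 : ℝ) := by
  obtain ⟨k, rfl⟩ : ∃ k, m = k + 1 := ⟨m - 1, by omega⟩
  rw [Real.rpow_neg hr.le, Real.rpow_two, Nat.add_sub_cancel]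
  field_simp
  ring

/-- The weight `min(1, |x|²) / |x|^{m+1}` is integrable on `ℝ^m`. -/
lemma integrable_min_one_sq_mul_inv_pow {m : ℕ} (hm : 1 ≤ m) :
    Integrable (fun x : EuclideanSpace ℝ (Fin m) =>
      min 1 (‖x‖ ^ 2) * (‖x‖ ^ (m + 1))⁻¹) := by
  rw [integrable_radial_iff hm (f := fun r => min 1 (r ^ 2) * (r ^ (m + 1))⁻¹),
    ← Ioc_union_Ioi_eq_Ioi zero_le_one, integrableOn_union]
  constructor
  · refine (integrableOn_const (C := (1 : ℝ)) (by simp)).congr_fun ?_ measurableSet_Ioc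
    intro r hr
    have hr0 : 0 < r := hr.1
    have h := pow_pred_mul_inv_pow_succ hm hr0
    rw [Real.rpow_neg hr0.le, Real.rpow_two] at h
    have hmin : min 1 (r ^ 2) = r ^ 2 := min_eq_right (pow_le_one₀ hr0.le hr.2)
    simp only [hmin]
    rw [mul_left_comm, h, mul_inv_cancel₀ (by positivity)]
  · refine (integrableOn_Ioi_rpow_of_lt (by norm_num : (-2 : ℝ) < -1) one_pos).congr_fun ?_
      measurableSet_Ioi
    intro r (hr : 1 < r)
    have hmin : min 1 (r ^ 2) = 1 := min_eq_left (one_le_pow₀ hr.le)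
    simp only [hmin, one_mul]
    exact (pow_pred_mul_inv_pow_succ hm (one_pos.trans hr)).symm

section SecondDifference

variable {E : Type*} [NormedAddCommGroup E] [NormedSpace ℝ E]

/-- The even part of `φ`, minus its value at the origin. -/
noncomputable def halfSecondDifference (φ : E → ℝ) (x : E) : ℝ :=
  (φ x + φ (-x)) / 2 - φ 0

/-- The half second difference of a Schwartz function is `O(min(1, |x|²))`. -/
lemma SchwartzMap.exists_abs_halfSecondDifference_le (φ : SchwartzMap E ℝ) :
    ∃ C : ℝ, 0 ≤ C ∧ ∀ x, |halfSecondDifference φ x| ≤ C * min 1 (‖x‖ ^ 2) := by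
  set A := SchwartzMap.seminorm ℝ 0 0 φ
  set φ' := SchwartzMap.fderivCLM ℝ E ℝ φ
  set φ'' := SchwartzMap.fderivCLM ℝ E _ φ'
  set B := SchwartzMap.seminorm ℝ 0 0 φ''
  have hA : 0 ≤ A := apply_nonneg _ _
  have hB : 0 ≤ B := apply_nonneg _ _
  have hφ : ∀ x, |φ x| ≤ A := fun x => SchwartzMap.norm_le_seminorm ℝ φ x
  have hlip : ∀ x y, ‖φ' x - φ' y‖ ≤ B * ‖x - y‖ := fun x y =>
    convex_univ.norm_image_sub_le_of_norm_fderiv_le (𝕜 := ℝ)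
      (fun z _ => φ'.differentiableAt)
      (fun z _ => SchwartzMap.norm_le_seminorm ℝ φ'' z) (mem_univ _) (mem_univ _)
  have hd : ∀ x, HasFDerivAt (halfSecondDifference φ)
      ((2⁻¹ : ℝ) • (φ' x - φ' (-x))) x := by
    intro x
    have h1 : HasFDerivAt φ (φ' x) x := φ.differentiableAt.hasFDerivAt
    have h2 : HasFDerivAt φ (φ' (-x)) (-x) := φ.differentiableAt.hasFDerivAt
    have h3 := h2.comp x (hasFDerivAt_id x).neg
    have h4 := ((h1.add h3).const_smul (2⁻¹ : ℝ)).sub_const (φ 0)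
    refine (h4.congr_of_eventuallyEq (Eventually.of_forall fun y => ?_)).congr_fderiv ?_
    · simp [halfSecondDifference]
      ring
    · ext v
      simp [sub_eq_add_neg]
  have hquad : ∀ x, |halfSecondDifference φ x| ≤ B * ‖x‖ ^ 2 := by
    intro x
    have h := (convex_closedBall (0 : E) ‖x‖).norm_image_sub_le_of_norm_hasFDerivWithin_le
      (f := halfSecondDifference φ) (C := B * ‖x‖)
      (fun z _ => (hd z).hasFDerivWithinAt) ?_
      (Metric.mem_closedBall_self (norm_nonneg x)) (by simp : x ∈ Metric.closedBall (0 : E) ‖x‖)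
    · have h0 : halfSecondDifference φ 0 = 0 := by simp [halfSecondDifference]
      rw [h0, sub_zero, sub_zero, Real.norm_eq_abs] at h
      linarith [h, sq ‖x‖, mul_assoc B ‖x‖ ‖x‖, congrArg (B * ·) (sq ‖x‖)]
    · intro z hz
      have hz' : ‖z‖ ≤ ‖x‖ := by simpa using hz
      have h1 := hlip z (-z)
      have h2 : ‖z - -z‖ ≤ 2 * ‖x‖ := by
        rw [sub_neg_eq_add]
        linarith [norm_add_le z z]
      rw [norm_smul, Real.norm_eq_abs, abs_of_pos (by norm_num : (0 : ℝ) < 2⁻¹)]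
      nlinarith [mul_le_mul_of_nonneg_left h2 hB]
  have hbdd : ∀ x, |halfSecondDifference φ x| ≤ 2 * A := by
    intro x
    have h1 := abs_le.1 (hφ x)
    have h2 := abs_le.1 (hφ (-x))
    have h3 := abs_le.1 (hφ 0)
    rw [halfSecondDifference, abs_le]
    constructor <;> linarith
  refine ⟨2 * A + B, by positivity, fun x => ?_⟩
  rcases le_total 1 (‖x‖ ^ 2) with h | h
  · rw [min_eq_left h]
    linarith [hbdd x]
  · rw [min_eq_right h]
    nlinarith [hquad x, sq_nonneg ‖x‖, mul_nonneg hA (sq_nonneg ‖x‖)]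

end SecondDifference

/-- Pairing with an integrable radial weight sees only the half second difference and the mean. -/
lemma integral_radial_mul_eq {m : ℕ} {w : ℝ → ℝ} (φ : SchwartzMap (EuclideanSpace ℝ (Fin m)) ℝ)
    (hw : Integrable (fun x : EuclideanSpace ℝ (Fin m) => w ‖x‖)) :
    (∫ x, w ‖x‖ * φ x) - φ 0 * ∫ x : EuclideanSpace ℝ (Fin m), w ‖x‖ =
      ∫ x, w ‖x‖ * halfSecondDifference φ x := by
  have h1 : Integrable (fun x => w ‖x‖ * φ x) :=
    hw.mul_bdd (c := SchwartzMap.seminorm ℝ 0 0 φ) φ.continuous.aestronglyMeasurable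
      (Eventually.of_forall fun x => SchwartzMap.norm_le_seminorm ℝ φ x)
  have h2 : Integrable (fun x => w ‖x‖ * φ (-x)) := by simpa using h1.comp_neg
  have h3 : ∫ x, w ‖x‖ * φ (-x) = ∫ x, w ‖x‖ * φ x := by
    simpa using integral_neg_eq_self (fun x => w ‖x‖ * φ x) volume
  have h4 : ∀ x, w ‖x‖ * halfSecondDifference φ x =
      (w ‖x‖ * φ x + w ‖x‖ * φ (-x)) / 2 - φ 0 * w ‖x‖ := by
    intro x
    rw [halfSecondDifference]
    ring
  simp_rw [h4]
  have h5 : Integrable (fun x => (w ‖x‖ * φ x + w ‖x‖ * φ (-x)) / 2) := (h1.add h2).div_const 2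
  rw [integral_sub h5 (hw.const_mul _), integral_div,
    integral_add h1 h2, h3, integral_const_mul]
  ring

/-- Radial weights converging to `|x|^{-(m+1)}` and dominated by it, once their means are
subtracted, converge to one and the same functional. -/
lemma tendsto_integral_radial_mul_sub {m : ℕ} (hm : 1 ≤ m)
    (φ : SchwartzMap (EuclideanSpace ℝ (Fin m)) ℝ) {w : ℝ → ℝ → ℝ} {D : ℝ}
    (hint : ∀ t, 0 < t → Integrable (fun x : EuclideanSpace ℝ (Fin m) => w t ‖x‖))
    (hbound : ∀ t, 0 < t → ∀ r, 0 < r → |w t r| ≤ D * (r ^ (m + 1))⁻¹)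
    (hlim : ∀ r, 0 < r → Tendsto (fun t => w t r) (𝓝[>] 0) (𝓝 (r ^ (m + 1))⁻¹)) :
    Tendsto (fun t => (∫ x, w t ‖x‖ * φ x) -
        φ 0 * ∫ x : EuclideanSpace ℝ (Fin m), w t ‖x‖) (𝓝[>] 0)
      (𝓝 (∫ x, (‖x‖ ^ (m + 1))⁻¹ * halfSecondDifference φ x)) := by
  obtain ⟨C, hC, hψ⟩ := φ.exists_abs_halfSecondDifference_le
  have hcont : Continuous (halfSecondDifference φ) := by
    have := φ.continuous
    unfold halfSecondDifference
    fun_prop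
  have h0 : halfSecondDifference φ 0 = 0 := by simp [halfSecondDifference]
  have key : Tendsto (fun t => ∫ x, w t ‖x‖ * halfSecondDifference φ x) (𝓝[>] 0)
      (𝓝 (∫ x, (‖x‖ ^ (m + 1))⁻¹ * halfSecondDifference φ x)) := by
    refine tendsto_integral_filter_of_dominated_convergence
      (fun x => D * C * (min 1 (‖x‖ ^ 2) * (‖x‖ ^ (m + 1))⁻¹)) ?_ ?_
      ((integrable_min_one_sq_mul_inv_pow hm).const_mul _) ?_
    · filter_upwards [self_mem_nhdsWithin] with t ht
      exact (hint t ht).aestronglyMeasurable.mul hcont.aestronglyMeasurable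
    · filter_upwards [self_mem_nhdsWithin] with t ht
      refine Eventually.of_forall fun x => ?_
      rcases eq_or_ne x 0 with rfl | hx
      · simp [h0]
      · have hb := hbound t ht ‖x‖ (norm_pos_iff.2 hx)
        calc ‖w t ‖x‖ * halfSecondDifference φ x‖
            = |w t ‖x‖| * |halfSecondDifference φ x| := by rw [Real.norm_eq_abs, abs_mul]
          _ ≤ (D * (‖x‖ ^ (m + 1))⁻¹) * (C * min 1 (‖x‖ ^ 2)) :=
              mul_le_mul hb (hψ x) (abs_nonneg _) ((abs_nonneg _).trans hb)
          _ = _ := by ring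
    · refine Eventually.of_forall fun x => ?_
      rcases eq_or_ne x 0 with rfl | hx
      · simp [h0]
      · exact (hlim _ (norm_pos_iff.2 hx)).mul_const _
  refine key.congr' ?_
  filter_upwards [self_mem_nhdsWithin] with t ht
  exact (integral_radial_mul_eq φ (hint t ht)).symm

section Truncation

lemma pow_pred_mul_indicator_eqOn {m : ℕ} (hm : 1 ≤ m) (ε : ℝ) :
    EqOn (fun r : ℝ => r ^ (m - 1) * (Ici ε).indicator (fun s => (s ^ (m + 1))⁻¹) r)
      ((Ici ε).indicator fun r => r ^ (-2 : ℝ)) (Ioi 0) := by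
  intro r (hr : 0 < r)
  by_cases h : r ∈ Ici ε
  · simp only [indicator_of_mem h, pow_pred_mul_inv_pow_succ hm hr]
  · simp only [indicator_of_notMem h, mul_zero]

lemma integrable_truncated_inv_pow {m : ℕ} (hm : 1 ≤ m) {ε : ℝ} (hε : 0 < ε) :
    Integrable (fun x : EuclideanSpace ℝ (Fin m) =>
      (Ici ε).indicator (fun s => (s ^ (m + 1))⁻¹) ‖x‖) := by
  rw [integrable_radial_iff hm,
    integrableOn_congr_fun (pow_pred_mul_indicator_eqOn hm ε) measurableSet_Ioi]
  refine Integrable.integrableOn ?_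
  rw [integrable_indicator_iff measurableSet_Ici, integrableOn_Ici_iff_integrableOn_Ioi]
  exact integrableOn_Ioi_rpow_of_lt (by norm_num) hε

lemma integral_truncated_inv_pow {m : ℕ} (hm : 1 ≤ m) {ε : ℝ} (hε : 0 < ε) :
    ∫ x : EuclideanSpace ℝ (Fin m), (Ici ε).indicator (fun s => (s ^ (m + 1))⁻¹) ‖x‖ =
      sphereArea m / ε := by
  rw [integral_radial_eq_sphereArea_mul hm,
    setIntegral_congr_fun measurableSet_Ioi (pow_pred_mul_indicator_eqOn hm ε),
    setIntegral_indicator measurableSet_Ici,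
    inter_eq_self_of_subset_right (Ici_subset_Ioi.2 hε),
    integral_Ici_eq_integral_Ioi, integral_Ioi_rpow_of_lt (by norm_num) hε]
  norm_num [Real.rpow_neg_one, div_eq_mul_inv]

end Truncation

section PoissonKernel

/-- Up to the constant `2/σ_{m+1}`, the radial profile of `∂_t P`. -/
noncomputable def poissonDerivProfile (m : ℕ) (t r : ℝ) : ℝ :=
  (t ^ 2 + r ^ 2) ^ (-(((m : ℝ) + 1) / 2)) -
    ((m : ℝ) + 1) * t ^ 2 * (t ^ 2 + r ^ 2) ^ (-(((m : ℝ) + 1) / 2) - 1)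

lemma deriv_poissonP (m : ℕ) {t : ℝ} (ht : 0 < t) (x : EuclideanSpace ℝ (Fin m)) :
    deriv (fun s => poissonP m s x) t =
      2 / sphereArea (m + 1) * poissonDerivProfile m t ‖x‖ := by
  have hpos : 0 < t ^ 2 + ‖x‖ ^ 2 := by positivity
  have h1 : HasDerivAt (fun s : ℝ => s ^ 2 + ‖x‖ ^ 2) (2 * t) t := by
    simpa using (hasDerivAt_pow 2 t).add_const (‖x‖ ^ 2)
  have h2 := h1.rpow_const (p := -(((m : ℝ) + 1) / 2)) (Or.inl hpos.ne')
  have h3 := ((hasDerivAt_id t).const_mul (2 / sphereArea (m + 1))).mul h2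
  refine HasDerivAt.deriv (h3.congr_deriv ?_)
  simp only [poissonDerivProfile, id]
  ring

lemma sq_rpow_neg_half_succ (m : ℕ) {r : ℝ} (hr : 0 < r) :
    (r ^ 2) ^ (-(((m : ℝ) + 1) / 2)) = (r ^ (m + 1))⁻¹ := by
  rw [Real.rpow_neg (sq_nonneg r), ← Real.rpow_natCast r 2, ← Real.rpow_mul hr.le,
    ← Real.rpow_natCast r (m + 1)]
  congr 2
  push_cast
  ring

lemma rpow_neg_half_succ_le (m : ℕ) (t : ℝ) {r : ℝ} (hr : 0 < r) :
    (t ^ 2 + r ^ 2) ^ (-(((m : ℝ) + 1) / 2)) ≤ (r ^ (m + 1))⁻¹ := by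
  calc (t ^ 2 + r ^ 2) ^ (-(((m : ℝ) + 1) / 2))
      ≤ (r ^ 2) ^ (-(((m : ℝ) + 1) / 2)) :=
        Real.rpow_le_rpow_of_nonpos (by positivity) (by nlinarith [sq_nonneg t])
          (by rw [neg_nonpos]; positivity)
    _ = (r ^ (m + 1))⁻¹ := sq_rpow_neg_half_succ m hr

lemma abs_poissonDerivProfile_le (m : ℕ) {t : ℝ} (ht : 0 < t) (r : ℝ) :
    |poissonDerivProfile m t r| ≤ ((m : ℝ) + 2) * (t ^ 2 + r ^ 2) ^ (-(((m : ℝ) + 1) / 2)) := by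
  have hpos : 0 < t ^ 2 + r ^ 2 := by positivity
  set q := (t ^ 2 + r ^ 2) ^ (-(((m : ℝ) + 1) / 2)) with hq
  have hq0 : 0 ≤ q := by positivity
  have h1 : t ^ 2 * (q / (t ^ 2 + r ^ 2)) ≤ q := by
    rw [← mul_div_assoc, div_le_iff₀ hpos]
    nlinarith [mul_nonneg hq0 (sq_nonneg r)]
  have h2 : 0 ≤ t ^ 2 * (q / (t ^ 2 + r ^ 2)) := by positivity
  rw [poissonDerivProfile, Real.rpow_sub_one hpos.ne', ← hq, mul_assoc, abs_le]
  have hm : (0 : ℝ) ≤ m := m.cast_nonneg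
  constructor <;> nlinarith [mul_le_mul_of_nonneg_left h1 (by positivity : (0 : ℝ) ≤ m + 1),
    mul_nonneg (by positivity : (0 : ℝ) ≤ m + 1) h2, mul_nonneg hm hq0]

lemma tendsto_poissonDerivProfile (m : ℕ) {r : ℝ} (hr : 0 < r) :
    Tendsto (fun t => poissonDerivProfile m t r) (𝓝[>] 0) (𝓝 (r ^ (m + 1))⁻¹) := by
  have hne : (0 : ℝ) ^ 2 + r ^ 2 ≠ 0 := by positivity
  have hc : ContinuousAt (fun t => poissonDerivProfile m t r) 0 := by
    unfold poissonDerivProfile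
    have hb : ContinuousAt (fun t : ℝ => t ^ 2 + r ^ 2) 0 := by fun_prop
    exact (hb.rpow_const (Or.inl hne)).sub
      (ContinuousAt.mul (by fun_prop) (hb.rpow_const (Or.inl hne)))
  have h := hc.tendsto.mono_left (nhdsWithin_le_nhds (s := Ioi 0))
  have h0 : poissonDerivProfile m 0 r = (r ^ (m + 1))⁻¹ := by
    simp [poissonDerivProfile, sq_rpow_neg_half_succ m hr]
  rwa [h0] at h

lemma continuous_poissonDerivProfile (m : ℕ) {t : ℝ} (ht : 0 < t) :
    Continuous (poissonDerivProfile m t) := by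
  have hb : Continuous (fun r : ℝ => t ^ 2 + r ^ 2) := by fun_prop
  have hne : ∀ r : ℝ, t ^ 2 + r ^ 2 ≠ 0 := fun r => by positivity
  unfold poissonDerivProfile
  exact (hb.rpow_const fun r => Or.inl (hne r)).sub
    (continuous_const.mul (hb.rpow_const fun r => Or.inl (hne r)))

lemma integrable_poissonDerivProfile (m : ℕ) {t : ℝ} (ht : 0 < t) :
    Integrable (fun x : EuclideanSpace ℝ (Fin m) => poissonDerivProfile m t ‖x‖) := by
  have hj : Integrable (fun x : EuclideanSpace ℝ (Fin m) =>
      ((1 : ℝ) + ‖x‖ ^ 2) ^ (-((m : ℝ) + 1) / 2)) :=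
    integrable_rpow_neg_one_add_norm_sq (by simp)
  set d := min 1 (t ^ 2)
  have hd : 0 < d := by positivity
  refine (hj.const_mul (((m : ℝ) + 2) * d ^ (-(((m : ℝ) + 1) / 2)))).mono'
    ((continuous_poissonDerivProfile m ht).comp continuous_norm).aestronglyMeasurable
    (Eventually.of_forall fun x => (abs_poissonDerivProfile_le m ht ‖x‖).trans ?_)
  rw [mul_assoc, neg_div, ← Real.mul_rpow hd.le (by positivity)]
  refine mul_le_mul_of_nonneg_left (Real.rpow_le_rpow_of_nonpos (by positivity) ?_
    (by rw [neg_nonpos]; positivity)) (by positivity)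
  nlinarith [min_le_left 1 (t ^ 2), min_le_right 1 (t ^ 2), sq_nonneg ‖x‖,
    mul_le_mul_of_nonneg_right (min_le_left 1 (t ^ 2)) (sq_nonneg ‖x‖)]

/-- The `t`-derivative of the Poisson kernel has mean zero. -/
lemma integral_poissonDerivProfile {m : ℕ} (hm : 1 ≤ m) {t : ℝ} (ht : 0 < t) :
    ∫ x : EuclideanSpace ℝ (Fin m), poissonDerivProfile m t ‖x‖ = 0 := by
  have hderiv : ∀ r ∈ Ici (0 : ℝ), HasDerivAt
      (fun r : ℝ => -(r ^ m * (t ^ 2 + r ^ 2) ^ (-(((m : ℝ) + 1) / 2))))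
      (r ^ (m - 1) * poissonDerivProfile m t r) r := by
    intro r _
    have hpos : 0 < t ^ 2 + r ^ 2 := by positivity
    have h1 : HasDerivAt (fun s : ℝ => t ^ 2 + s ^ 2) (2 * r) r := by
      simpa using (hasDerivAt_pow 2 r).const_add (t ^ 2)
    have h2 := h1.rpow_const (p := -(((m : ℝ) + 1) / 2)) (Or.inl hpos.ne')
    refine ((hasDerivAt_pow m r).mul h2).neg.congr_deriv ?_
    obtain ⟨k, rfl⟩ : ∃ k, m = k + 1 := ⟨m - 1, by omega⟩
    rw [poissonDerivProfile, Real.rpow_sub_one hpos.ne']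
    simp only [Nat.add_sub_cancel]
    push_cast
    field_simp
    ring
  have hlim : Tendsto (fun r : ℝ => -(r ^ m * (t ^ 2 + r ^ 2) ^ (-(((m : ℝ) + 1) / 2))))
      atTop (𝓝 0) := by
    rw [← neg_zero]
    refine (squeeze_zero' ?_ ?_ tendsto_inv_atTop_zero).neg
    · filter_upwards [eventually_gt_atTop 0] with r hr
      positivity
    · filter_upwards [eventually_gt_atTop 0] with r hr
      calc r ^ m * (t ^ 2 + r ^ 2) ^ (-(((m : ℝ) + 1) / 2)) ≤ r ^ m * (r ^ (m + 1))⁻¹ :=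
            mul_le_mul_of_nonneg_left (rpow_neg_half_succ_le m t hr) (by positivity)
        _ = r⁻¹ := by rw [pow_succ]; field_simp
  have hm0 : m ≠ 0 := by omega
  rw [integral_radial_eq_sphereArea_mul hm, integral_Ioi_of_hasDerivAt_of_tendsto' hderiv
    ((integrable_radial_iff hm).1 (integrable_poissonDerivProfile m ht)) hlim]
  simp [hm0]

end PoissonKernel

theorem A_minus2_boundary_value_finite_part
    (m : ℕ) (hm : 1 ≤ m) (φ : SchwartzMap (EuclideanSpace ℝ (Fin m)) ℝ) :
    ∃ L : ℝ,
      Filter.Tendsto (fun ε : ℝ =>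
          (∫ x in {x : EuclideanSpace ℝ (Fin m) | ε ≤ ‖x‖}, φ x / ‖x‖ ^ (m + 1)) -
            sphereArea m / ε * φ 0)
        (nhdsWithin 0 (Set.Ioi 0)) (nhds L) ∧
      Filter.Tendsto (fun t : ℝ =>
          ∫ x : EuclideanSpace ℝ (Fin m), deriv (fun s => poissonP m s x) t * φ x)
        (nhdsWithin 0 (Set.Ioi 0)) (nhds (2 / sphereArea (m + 1) * L)) := by
  refine ⟨∫ x, (‖x‖ ^ (m + 1))⁻¹ * halfSecondDifference φ x, ?_, ?_⟩
  · have h := tendsto_integral_radial_mul_sub hm φ (D := 1)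
      (w := fun ε => (Ici ε).indicator fun s => (s ^ (m + 1))⁻¹)
      (fun ε hε => integrable_truncated_inv_pow hm hε) ?_ ?_
    · refine h.congr' ?_
      filter_upwards [self_mem_nhdsWithin] with ε hε
      rw [integral_truncated_inv_pow hm hε, mul_comm (φ 0),
        ← integral_indicator (measurableSet_le measurable_const measurable_norm)]
      congr 2
      ext x
      by_cases hx : ε ≤ ‖x‖ <;> simp [indicator, hx, div_eq_mul_inv, mul_comm]
    · intro ε _ r hr
      rw [one_mul]
      by_cases h : ε ≤ r
      · simp [indicator, h, abs_of_pos hr]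
      · simp [indicator, h, hr.le]
    · intro r hr
      refine tendsto_const_nhds.congr' ?_
      filter_upwards [Ioo_mem_nhdsGT hr] with ε hε
      simp [indicator, hε.2.le]
  · have h := tendsto_integral_radial_mul_sub hm φ (D := (m : ℝ) + 2)
      (w := poissonDerivProfile m)
      (fun t ht => integrable_poissonDerivProfile m ht)
      (fun t ht r hr => (abs_poissonDerivProfile_le m ht r).trans
        (mul_le_mul_of_nonneg_left (rpow_neg_half_succ_le m t hr) (by positivity)))
      (fun r hr => tendsto_poissonDerivProfile m hr)
    refine (h.const_mul (2 / sphereArea (m + 1))).congr' ?_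
    filter_upwards [self_mem_nhdsWithin] with t ht
    simp_rw [integral_poissonDerivProfile hm ht, deriv_poissonP m ht, mul_assoc]
    rw [integral_const_mul, mul_zero, sub_zero]
end
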